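/- Interpolation-type a priori estimate for divergence-form equations with small oscillation (Proposition 5.2). Let s ∈ (0,1), β ∈ (s, min{1,2s}), q = n/(2s−β), and 0 < λ ≤ Λ. Then for any δ > 0 there exist C_δ and η_δ > 0, depending only on δ, n, s, β, λ, Λ, such that the following holds. Let (K(x,·))_{x∈ℝⁿ} define a divergence-form nonlocal operator L of order 2s with ellipticity constants λ, Λ, satisfying for all x, h ∈ ℝⁿ and ρ > 0: |σ_{−h}K(x+h,·) − K(x,·)|(B_{2ρ}(x)∖B_ρ(x)) ≤ η_δ ρ^{−2s} and |τ⁻_x K(x,·) − τ⁺_x K(x,·)|(B_{2ρ}∖B_ρ) ≤ η_δ ρ^{−2s}. Then [u]_{C^β(B_{1/2})} ≤ δ [u]_{C^β(ℝⁿ)} + C_δ (‖u‖_{L^∞(B₁)} + ‖f‖_{L^q(B₁)}) for any compactly supported u ∈ C^β(ℝⁿ) that is a weak solution of L(u,x) = f in B₁. -/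

import Mathlib

open MeasureTheory Metric Set
open scoped ENNReal Topology RealInnerProductSpace

noncomputable section

abbrev Euc (n : ℕ) := EuclideanSpace ℝ (Fin n)

variable {n : ℕ}

def hDeg (σ : ℝ) : ℕ := ⌈σ⌉₊ - 1

def hSemiOn (σ : ℝ) (Ω A : Set (Euc n)) (u : Euc n → ℝ) : ℝ≥0∞ :=
  ⨆ (x : A) (y : A),
    ENNReal.ofReal
      (‖iteratedFDerivWithin ℝ (hDeg σ) u Ω ↑x - iteratedFDerivWithin ℝ (hDeg σ) u Ω ↑y‖ /
        ‖(x : Euc n) - (y : Euc n)‖ ^ (σ - (hDeg σ : ℝ)))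

def hSemi (σ : ℝ) (Ω : Set (Euc n)) (u : Euc n → ℝ) : ℝ≥0∞ := hSemiOn σ Ω Ω u

def hNormOn (σ : ℝ) (Ω A : Set (Euc n)) (u : Euc n → ℝ) : ℝ≥0∞ :=
  (∑ j ∈ Finset.range (hDeg σ + 1), ⨆ x : A, ENNReal.ofReal ‖iteratedFDerivWithin ℝ j u Ω ↑x‖) +
    hSemiOn σ Ω A u

def hNorm (σ : ℝ) (Ω : Set (Euc n)) (u : Euc n → ℝ) : ℝ≥0∞ := hNormOn σ Ω Ω u

def HolderMem (σ : ℝ) (Ω : Set (Euc n)) (u : Euc n → ℝ) : Prop :=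
  ContDiffOn ℝ (hDeg σ) u Ω ∧ hNorm σ Ω u ≠ ⊤

def HolderMemLoc (σ : ℝ) (Ω : Set (Euc n)) (u : Euc n → ℝ) : Prop :=
  ContDiffOn ℝ (hDeg σ) u Ω ∧
    ∀ A : Set (Euc n), IsCompact A → A ⊆ Ω → hNormOn σ Ω A u ≠ ⊤

def supNorm (Ω : Set (Euc n)) (u : Euc n → ℝ) : ℝ≥0∞ :=
  ⨆ x : Ω, ENNReal.ofReal |u ↑x|

def supNormW (τ : ℝ) (u : Euc n → ℝ) : ℝ≥0∞ :=
  ⨆ x : Euc n, ENNReal.ofReal (|u x| / (1 + ‖x‖ ^ τ))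

def IsLevyMeasure (K : Measure (Euc n)) : Prop :=
  K {0} = 0 ∧ (∫⁻ y, ENNReal.ofReal (min 1 (‖y‖ ^ 2)) ∂K) ≠ ⊤ ∧
    Measure.map (fun y => -y) K = K

def UnifElliptic (s lam Lam : ℝ) (K : Measure (Euc n)) : Prop :=
  (∀ r : ℝ, 0 < r →
    ENNReal.ofReal (r ^ (2 * s)) * K (ball 0 (2 * r) \ ball 0 r) ≤ ENNReal.ofReal Lam) ∧
  (∀ r : ℝ, 0 < r → ∀ e : Euc n, ‖e‖ = 1 →
    ENNReal.ofReal lam ≤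
      ENNReal.ofReal (r ^ (2 * s - 2)) * ∫⁻ y in ball 0 r, ENNReal.ofReal (⟪e, y⟫ ^ 2) ∂K)

def Lop (K : Euc n → Measure (Euc n)) (u : Euc n → ℝ) (x : Euc n) : ℝ :=
  (1 / 2) * ∫ y, (2 * u x - u (x + y) - u (x - y)) ∂(K x)

def LopTI (K : Measure (Euc n)) (u : Euc n → ℝ) (x : Euc n) : ℝ :=
  (1 / 2) * ∫ y, (2 * u x - u (x + y) - u (x - y)) ∂K

def SolvesPtwise (K : Euc n → Measure (Euc n)) (u f : Euc n → ℝ) (Ω : Set (Euc n)) : Prop :=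
  ∀ x ∈ Ω, Integrable (fun y => 2 * u x - u (x + y) - u (x - y)) (K x) ∧ Lop K u x = f x

def tvDiff (μ ν : Measure (Euc n)) (A : Set (Euc n)) : ℝ≥0∞ :=
  (μ.restrict A - ν.restrict A) Set.univ + (ν.restrict A - μ.restrict A) Set.univ

def kernelHolder (s θ : ℝ) (K : Measure (Euc n)) : ℝ≥0∞ :=
  ⨆ (ρ : ℝ) (_ : 0 < ρ) (x : Euc n) (x' : Euc n)
      (_ : x ∈ ball 0 (ρ / 2)) (_ : x' ∈ ball 0 (ρ / 2)) (_ : x ≠ x'),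
    ENNReal.ofReal (ρ ^ (2 * s + θ) / ‖x - x'‖ ^ θ) *
      tvDiff (Measure.map (fun y => x - y) K) (Measure.map (fun y => x' - y) K)
        (ball 0 (2 * ρ) \ ball 0 ρ)

def KantCond (s γ : ℝ) (μ ν : Measure (Euc n)) (c : ℝ) : Prop :=
  ∀ ρ : ℝ, 0 < ρ → ∀ φ : Euc n → ℝ, ContDiff ℝ (hDeg γ) φ →
    hSemi γ Set.univ φ ≤ 1 → φ 0 = 0 →
    |(∫ y in ball 0 (2 * ρ) \ ball 0 ρ, φ y ∂μ) -
        ∫ y in ball 0 (2 * ρ) \ ball 0 ρ, φ y ∂ν| ≤ c * ρ ^ (γ - 2 * s)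


def MeasKernel (K : Euc n → Measure (Euc n)) : Prop :=
  ∀ B : Set (Euc n), MeasurableSet B → Measurable fun x => K x B

/-- Symmetry of a divergence-form kernel: `∫_A K(x,B) dx = ∫_B K(x,A) dx`
for all disjoint Borel sets. -/
def DivSymmetric (K : Euc n → Measure (Euc n)) : Prop :=
  ∀ A B : Set (Euc n), MeasurableSet A → MeasurableSet B → Disjoint A B →
    ∫⁻ x in A, K x B = ∫⁻ x in B, K x A

/-- Uniform ellipticity of a divergence-form kernel. -/
def DivElliptic (s lam Lam : ℝ) (K : Euc n → Measure (Euc n)) : Prop :=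
  (∀ x : Euc n, ∀ r : ℝ, 0 < r →
    ENNReal.ofReal (r ^ (2 * s)) * K x (ball x (2 * r) \ ball x r) ≤ ENNReal.ofReal Lam) ∧
  (∀ x : Euc n, ∀ r : ℝ, 0 < r → ∀ e : Euc n, ‖e‖ = 1 →
    ENNReal.ofReal lam ≤
      ENNReal.ofReal (r ^ (2 * s - 2)) *
        ∫⁻ z in ball x r, ENNReal.ofReal (⟪e, x - z⟫ ^ 2) ∂(K x))

/-- Weak solution of the divergence-form equation `L(u,x) = f` in `Ω`. -/
def WeakSol (K : Euc n → Measure (Euc n)) (u f : Euc n → ℝ) (Ω : Set (Euc n)) : Prop :=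
  (∫⁻ x in Ω, ∫⁻ z, ENNReal.ofReal ((u x - u z) ^ 2) ∂(K x)) ≠ ⊤ ∧
  (∫⁻ x in Ωᶜ, ∫⁻ z in Ω, ENNReal.ofReal ((u x - u z) ^ 2) ∂(K x)) ≠ ⊤ ∧
  ∀ η : Euc n → ℝ, ContDiff ℝ (⊤ : ℕ∞) η → HasCompactSupport η → tsupport η ⊆ Ω →
    (1 / 2) * (∫ x, ∫ z, (u x - u z) * (η x - η z) ∂(K x)) = ∫ x, f x * η x

/-- `C^α` regularity in the `x`-variable of a divergence-form kernel (total variation). -/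
def XReg (s α M : ℝ) (K : Euc n → Measure (Euc n)) : Prop :=
  ∀ x h : Euc n, ∀ ρ : ℝ, 0 < ρ →
    tvDiff (Measure.map (fun z => z - h) (K (x + h))) (K x) (ball x (2 * ρ) \ ball x ρ) ≤
      ENNReal.ofReal (M * ‖h‖ ^ α * ρ ^ (-(2 * s)))

/-- Quantitative almost-evenness of a divergence-form kernel. -/
def AlmostEven (s α M : ℝ) (K : Euc n → Measure (Euc n)) : Prop :=
  ∀ x : Euc n, ∀ ρ : ℝ, 0 < ρ →
    tvDiff (Measure.map (fun z => z - x) (K x)) (Measure.map (fun z => x - z) (K x))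
        (ball 0 (2 * ρ) \ ball 0 ρ) ≤
      ENNReal.ofReal (M * ρ ^ (α - 2 * s))

/-- `C^θ` regularity in the `z`-variable of a divergence-form kernel (total variation). -/
def ZReg (s θ M : ℝ) (K : Euc n → Measure (Euc n)) : Prop :=
  ∀ x : Euc n, ∀ ρ : ℝ, 0 < ρ → ∀ h : Euc n, ‖h‖ < ρ / 2 →
    tvDiff (Measure.map (fun z => z - h) (K x)) (K x) (ball x (2 * ρ) \ ball x ρ) ≤
      ENNReal.ofReal (M * ‖h‖ ^ θ * ρ ^ (-(2 * s) - θ))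

def gradSup (u : Euc n → ℝ) : ℝ≥0∞ :=
  ⨆ x : Euc n, ENNReal.ofReal ‖fderiv ℝ u x‖

def gradSupOn (Ω : Set (Euc n)) (u : Euc n → ℝ) : ℝ≥0∞ :=
  ⨆ x : Ω, ENNReal.ofReal ‖fderiv ℝ u (x : Euc n)‖

def c1Norm (Ω : Set (Euc n)) (u : Euc n → ℝ) : ℝ≥0∞ :=
  supNorm Ω u + gradSupOn Ω u

/-- A measure without atom at the origin that obeys the scaling of a kernel of order `2s`. -/
def DyadicBound (s M : ℝ) (m : Measure (Euc n)) : Prop :=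
  m {0} = 0 ∧ ∀ ρ : ℝ, 0 < ρ →
    m (ball 0 (2 * ρ) \ ball 0 ρ) ≤ ENNReal.ofReal (M * ρ ^ (-(2 * s)))

/-- The constant of a geometric series. -/
def geomConst (t : ℝ) : ℝ := (1 - (2 : ℝ) ^ (-t))⁻¹

lemma geomConst_pos {t : ℝ} (ht : 0 < t) : 0 < geomConst t := by
  have : (2 : ℝ) ^ (-t) < 1 := Real.rpow_lt_one_of_one_lt_of_neg (by norm_num) (by linarith)
  exact inv_pos.2 (by linarith)

lemma lintegral_iUnion_le_geom {X : Type*} [MeasurableSpace X] {m : Measure X} {D : ℕ → Set X}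
    {F : X → ℝ≥0∞} {t a : ℝ} (ht : 0 < t) (ha : 0 ≤ a) (S : Set X) (hS : S ⊆ ⋃ j, D j)
    (h : ∀ j, ∫⁻ y in D j, F y ∂m ≤ ENNReal.ofReal (a * ((2 : ℝ) ^ (-t)) ^ j)) :
    ∫⁻ y in S, F y ∂m ≤ ENNReal.ofReal (geomConst t * a) := by
  have h0 : (0 : ℝ) ≤ (2 : ℝ) ^ (-t) := by positivity
  have h1 : (2 : ℝ) ^ (-t) < 1 := Real.rpow_lt_one_of_one_lt_of_neg (by norm_num) (by linarith)
  have hs := (hasSum_geometric_of_lt_one h0 h1).mul_left a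
  calc ∫⁻ y in S, F y ∂m ≤ ∫⁻ y in ⋃ j, D j, F y ∂m := lintegral_mono_set hS
    _ ≤ ∑' j, ∫⁻ y in D j, F y ∂m := lintegral_iUnion_le _ _
    _ ≤ ∑' j, ENNReal.ofReal (a * ((2 : ℝ) ^ (-t)) ^ j) := ENNReal.tsum_le_tsum h
    _ = ENNReal.ofReal (∑' j, a * ((2 : ℝ) ^ (-t)) ^ j) :=
        (ENNReal.ofReal_tsum_of_nonneg (fun j => by positivity) hs.summable).symm
    _ = ENNReal.ofReal (geomConst t * a) := by rw [hs.tsum_eq, geomConst, mul_comm]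

lemma setLIntegral_annulus_le {s M : ℝ} {m : Measure (Euc n)} (h : DyadicBound s M m)
    {p ρ : ℝ} (hp : 0 ≤ p) (hρ : 0 < ρ) :
    ∫⁻ y in ball 0 (2 * ρ) \ ball 0 ρ, ENNReal.ofReal (‖y‖ ^ p) ∂m ≤
      ENNReal.ofReal ((2 * ρ) ^ p * (M * ρ ^ (-(2 * s)))) := by
  calc ∫⁻ y in ball 0 (2 * ρ) \ ball 0 ρ, ENNReal.ofReal (‖y‖ ^ p) ∂m
      ≤ ∫⁻ y in ball 0 (2 * ρ) \ ball 0 ρ, ENNReal.ofReal ((2 * ρ) ^ p) ∂m := by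
        refine setLIntegral_mono' (measurableSet_ball.diff measurableSet_ball) fun y hy => ?_
        have : ‖y‖ < 2 * ρ := by simpa using hy.1
        gcongr
    _ = ENNReal.ofReal ((2 * ρ) ^ p) * m (ball 0 (2 * ρ) \ ball 0 ρ) := by simp
    _ ≤ ENNReal.ofReal ((2 * ρ) ^ p) * ENNReal.ofReal (M * ρ ^ (-(2 * s))) := by
        gcongr; exact h.2 ρ hρ
    _ = _ := (ENNReal.ofReal_mul (by positivity)).symm

lemma setLIntegral_ball_rpow_le {s M : ℝ} {m : Measure (Euc n)} (hM : 0 ≤ M)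
    (h : DyadicBound s M m) {p r : ℝ} (hp0 : 0 ≤ p) (hp : 2 * s < p) (hr : 0 < r) :
    ∫⁻ y in ball 0 r, ENNReal.ofReal (‖y‖ ^ p) ∂m ≤
      ENNReal.ofReal (geomConst (p - 2 * s) * ((2 : ℝ) ^ (2 * s) * M * r ^ (p - 2 * s))) := by
  have h0 : ∫⁻ y in ball 0 r, ENNReal.ofReal (‖y‖ ^ p) ∂m =
      ∫⁻ y in ball 0 r \ {0}, ENNReal.ofReal (‖y‖ ^ p) ∂m :=
    setLIntegral_congr (sdiff_null_ae_eq_self h.1).symm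
  rw [h0]
  refine lintegral_iUnion_le_geom (t := p - 2 * s)
    (D := fun j : ℕ => ball 0 (2 * (r * 2⁻¹ ^ (j + 1))) \ ball 0 (r * 2⁻¹ ^ (j + 1)))
    (by linarith) (by positivity) _ ?_ ?_
  · intro y hy
    have hy0 : 0 < ‖y‖ := norm_pos_iff.2 hy.2
    have hyr : ‖y‖ < r := by simpa using hy.1
    obtain ⟨j, hj1, hj2⟩ := exists_nat_pow_near_of_lt_one (x := ‖y‖ / r) (y := (2 : ℝ)⁻¹)
      (by positivity) ((div_le_one hr).2 hyr.le) (by norm_num) (by norm_num)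
    rw [lt_div_iff₀ hr] at hj1
    rw [div_le_iff₀ hr] at hj2
    rw [mem_iUnion]
    rcases hj2.lt_or_eq with hj2 | hj2
    · refine ⟨j, ?_, ?_⟩
      · rw [mem_ball_zero_iff, pow_succ]; linarith
      · rw [mem_ball_zero_iff, not_lt]; linarith
    · have hj : j ≠ 0 := by
        rintro rfl
        rw [pow_zero, one_mul] at hj2
        linarith
      obtain ⟨i, rfl⟩ := Nat.exists_eq_succ_of_ne_zero hj
      refine ⟨i, ?_, ?_⟩
      · rw [mem_ball_zero_iff, hj2]
        have : (0 : ℝ) < 2⁻¹ ^ (i + 1) * r := by positivity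
        rw [Nat.succ_eq_add_one, mul_comm r]
        exact lt_two_mul_self this
      · rw [mem_ball_zero_iff, not_lt, hj2]
        simp only [Nat.succ_eq_add_one]
        linarith
  · intro j
    refine (setLIntegral_annulus_le h hp0 (by positivity)).trans (le_of_eq ?_)
    congr 1
    have e1 : 2 * (r * 2⁻¹ ^ (j + 1)) = r * (2 : ℝ) ^ (-(j : ℝ)) := by
      rw [Real.rpow_neg (by norm_num), Real.rpow_natCast, inv_pow, pow_succ]
      field_simp
    have e2 : (r * 2⁻¹ ^ (j + 1) : ℝ) = r * (2 : ℝ) ^ (-(j : ℝ) - 1) := by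
      rw [Real.rpow_sub (by norm_num), Real.rpow_neg (by norm_num), Real.rpow_natCast, inv_pow,
        pow_succ, Real.rpow_one]
      field_simp
    rw [e1, e2, Real.mul_rpow hr.le (by positivity), Real.mul_rpow hr.le (by positivity),
      ← Real.rpow_mul (by norm_num), ← Real.rpow_mul (by norm_num), ← Real.rpow_natCast,
      ← Real.rpow_mul (by norm_num), sub_eq_add_neg p, Real.rpow_add hr]
    have : (2 : ℝ) ^ (-(j : ℝ) * p) * (2 : ℝ) ^ ((-(j : ℝ) - 1) * -(2 * s)) =
        (2 : ℝ) ^ (2 * s) * 2 ^ (-(p + -(2 * s)) * (j : ℝ)) := by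
      rw [← Real.rpow_add (by norm_num), ← Real.rpow_add (by norm_num)]
      congr 1; ring
    linear_combination M * r ^ p * r ^ (-(2 * s)) * this

lemma setLIntegral_compl_ball_rpow_le {s M : ℝ} {m : Measure (Euc n)} (hM : 0 ≤ M)
    (h : DyadicBound s M m) {p r : ℝ} (hp0 : 0 ≤ p) (hp : p < 2 * s) (hr : 0 < r) :
    ∫⁻ y in (ball 0 r)ᶜ, ENNReal.ofReal (‖y‖ ^ p) ∂m ≤
      ENNReal.ofReal (geomConst (2 * s - p) * ((2 : ℝ) ^ p * M * r ^ (p - 2 * s))) := by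
  refine lintegral_iUnion_le_geom (t := 2 * s - p)
    (D := fun j : ℕ => ball 0 (2 * (r * 2 ^ j)) \ ball 0 (r * 2 ^ j))
    (by linarith) (by positivity) _ ?_ ?_
  · intro y hy
    have hyr : r ≤ ‖y‖ := by simpa using hy
    obtain ⟨j, hj1, hj2⟩ := exists_nat_pow_near (x := ‖y‖ / r) (y := (2 : ℝ))
      ((one_le_div hr).2 hyr) (by norm_num)
    rw [le_div_iff₀ hr] at hj1
    rw [div_lt_iff₀ hr] at hj2
    rw [mem_iUnion]
    refine ⟨j, ?_, ?_⟩
    · rw [mem_ball_zero_iff]; rw [pow_succ] at hj2; linarith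
    · rw [mem_ball_zero_iff, not_lt]; linarith
  · intro j
    refine (setLIntegral_annulus_le h hp0 (by positivity)).trans (le_of_eq ?_)
    congr 1
    rw [Real.mul_rpow (by norm_num) (by positivity), Real.mul_rpow hr.le (by positivity),
      Real.mul_rpow hr.le (by positivity),
      ← Real.rpow_natCast, ← Real.rpow_mul (by norm_num), ← Real.rpow_mul (by norm_num),
      ← Real.rpow_natCast, ← Real.rpow_mul (by norm_num), sub_eq_add_neg p, Real.rpow_add hr]
    have : (2 : ℝ) ^ ((j : ℝ) * p) * (2 : ℝ) ^ ((j : ℝ) * -(2 * s)) =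
        2 ^ (-(2 * s - p) * (j : ℝ)) := by
      rw [← Real.rpow_add (by norm_num)]
      congr 1; ring
    linear_combination (2 : ℝ) ^ p * M * r ^ p * r ^ (-(2 * s)) * this

lemma DyadicBound.measure_compl_ball_le {s M : ℝ} {m : Measure (Euc n)} (hs : 0 < s) (hM : 0 ≤ M)
    (h : DyadicBound s M m) {r : ℝ} (hr : 0 < r) :
    m (ball 0 r)ᶜ ≤ ENNReal.ofReal (geomConst (2 * s) * (M * r ^ (-(2 * s)))) := by
  simpa using setLIntegral_compl_ball_rpow_le hM h le_rfl (by linarith) hr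

lemma DyadicBound.sigmaFinite {s M : ℝ} {m : Measure (Euc n)} (hs : 0 < s) (hM : 0 ≤ M)
    (h : DyadicBound s M m) : SigmaFinite m := by
  refine ⟨⟨⟨fun j => (ball 0 (1 / ((j : ℝ) + 1)))ᶜ ∪ {0}, fun _ => mem_univ _, fun j => ?_, ?_⟩⟩⟩
  · refine (measure_union_le _ _).trans_lt ?_
    rw [h.1, add_zero]
    exact (h.measure_compl_ball_le hs hM (by positivity)).trans_lt ENNReal.ofReal_lt_top
  · refine eq_univ_of_forall fun y => mem_iUnion.2 ?_
    by_cases hy : y = 0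
    · exact ⟨0, Or.inr hy⟩
    · obtain ⟨j, hj⟩ := exists_nat_one_div_lt (norm_pos_iff.2 hy)
      exact ⟨j, Or.inl (by simpa using hj.le)⟩

/-- The weight that dominates the integrand of the operator tested against a bump of size `r`. -/
def jumpWeight (β r : ℝ) (y : Euc n) : ℝ := if ‖y‖ < r then r⁻¹ * ‖y‖ ^ (β + 1) else ‖y‖ ^ β

lemma jumpWeight_nonneg {β r : ℝ} (hr : 0 < r) (y : Euc n) : 0 ≤ jumpWeight β r y := by
  unfold jumpWeight; split_ifs <;> positivity

lemma measurable_jumpWeight {β r : ℝ} : Measurable (jumpWeight β r : Euc n → ℝ) := by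
  unfold jumpWeight
  exact Measurable.ite (measurableSet_lt measurable_norm measurable_const)
    (by fun_prop) (by fun_prop)

/-- The constant in the integral bound for `jumpWeight`. -/
def weightConst (s β : ℝ) : ℝ :=
  geomConst (β + 1 - 2 * s) * (2 : ℝ) ^ (2 * s) + geomConst (2 * s - β) * (2 : ℝ) ^ β

lemma weightConst_pos {s β : ℝ} (h1 : 2 * s < β + 1) (h2 : β < 2 * s) : 0 < weightConst s β := by
  have := geomConst_pos (t := β + 1 - 2 * s) (by linarith)
  have := geomConst_pos (t := 2 * s - β) (by linarith)
  unfold weightConst; positivity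

lemma lintegral_jumpWeight_le {s β M r : ℝ} {m : Measure (Euc n)} (hM : 0 ≤ M)
    (h : DyadicBound s M m) (hβ : 0 < β) (h1 : 2 * s < β + 1) (h2 : β < 2 * s) (hr : 0 < r) :
    ∫⁻ y, ENNReal.ofReal (jumpWeight β r y) ∂m ≤
      ENNReal.ofReal (weightConst s β * M * r ^ (β - 2 * s)) := by
  have g1 := geomConst_pos (t := β + 1 - 2 * s) (by linarith)
  have g2 := geomConst_pos (t := 2 * s - β) (by linarith)
  rw [← lintegral_add_compl _ (measurableSet_ball (x := (0 : Euc n)) (ε := r))]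
  have e1 : ∫⁻ y in ball 0 r, ENNReal.ofReal (jumpWeight β r y) ∂m =
      ENNReal.ofReal r⁻¹ * ∫⁻ y in ball 0 r, ENNReal.ofReal (‖y‖ ^ (β + 1)) ∂m := by
    rw [← lintegral_const_mul _ (by fun_prop)]
    refine setLIntegral_congr_fun measurableSet_ball fun y hy => ?_
    have : ‖y‖ < r := by simpa using hy
    simp only [jumpWeight, if_pos this]
    rw [ENNReal.ofReal_mul (by positivity)]
  have e2 : ∫⁻ y in (ball 0 r)ᶜ, ENNReal.ofReal (jumpWeight β r y) ∂m =
      ∫⁻ y in (ball 0 r)ᶜ, ENNReal.ofReal (‖y‖ ^ β) ∂m := by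
    refine setLIntegral_congr_fun measurableSet_ball.compl fun y hy => ?_
    have : ¬ ‖y‖ < r := by simpa using hy
    simp only [jumpWeight, if_neg this]
  rw [e1, e2]
  calc _ ≤ ENNReal.ofReal r⁻¹ * ENNReal.ofReal (geomConst (β + 1 - 2 * s) *
          ((2 : ℝ) ^ (2 * s) * M * r ^ (β + 1 - 2 * s))) +
          ENNReal.ofReal (geomConst (2 * s - β) * ((2 : ℝ) ^ β * M * r ^ (β - 2 * s))) := by
        gcongr
        · exact setLIntegral_ball_rpow_le hM h (by linarith) (by linarith) hr
        · exact setLIntegral_compl_ball_rpow_le hM h (by linarith) (by linarith) hr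
    _ = _ := by
        rw [← ENNReal.ofReal_mul (by positivity), ← ENNReal.ofReal_add (by positivity)
          (by positivity)]
        congr 1
        have : r ^ (β + 1 - 2 * s) = r * r ^ (β - 2 * s) := by
          rw [show β + 1 - 2 * s = 1 + (β - 2 * s) by ring, Real.rpow_add hr, Real.rpow_one]
        rw [this, weightConst]
        field_simp

lemma integrable_of_le_jumpWeight {s β M r : ℝ} {m : Measure (Euc n)} (hM : 0 ≤ M)
    (h : DyadicBound s M m) (hβ : 0 < β) (h1 : 2 * s < β + 1) (h2 : β < 2 * s) (hr : 0 < r)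
    {F : Euc n → ℝ} {c : ℝ} (hF : AEStronglyMeasurable F m)
    (hFc : ∀ y, |F y| ≤ c * jumpWeight β r y) : Integrable F m := by
  have hw : Integrable (jumpWeight β r) m := by
    refine ⟨measurable_jumpWeight.aestronglyMeasurable, ?_⟩
    rw [hasFiniteIntegral_iff_ofReal (ae_of_all _ (jumpWeight_nonneg hr))]
    exact (lintegral_jumpWeight_le hM h hβ h1 h2 hr).trans_lt ENNReal.ofReal_lt_top
  exact (hw.const_mul c).mono' hF (ae_of_all _ hFc)

lemma measure_le_sub_add {X : Type*} [MeasurableSpace X] (μ ν : Measure X) [IsFiniteMeasure μ]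
    [IsFiniteMeasure ν] : μ ≤ (μ - ν) + ν := by
  obtain ⟨s, hs⟩ := exists_isHahnDecomposition μ ν
  have hm := hs.measurableSet
  calc μ = μ.restrict s + μ.restrict sᶜ := (Measure.restrict_add_restrict_compl hm).symm
    _ ≤ ν.restrict s + ((μ - ν).restrict sᶜ + ν.restrict sᶜ) := by
        refine add_le_add hs.le_on (le_of_eq ?_)
        rw [Measure.restrict_sub_eq_restrict_sub_restrict hm.compl,
          Measure.sub_add_cancel_of_le hs.ge_on_compl]
    _ = (μ - ν).restrict sᶜ + ν := by
        rw [add_left_comm, Measure.restrict_add_restrict_compl hm]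
    _ ≤ (μ - ν) + ν := add_le_add_left Measure.restrict_le_self _

/-- The dyadic annulus of radii `2 ^ j` and `2 ^ (j + 1)`. -/
def dyadicAnnulus (n : ℕ) (j : ℤ) : Set (Euc n) := ball 0 (2 * 2 ^ j) \ ball 0 (2 ^ j)

lemma mem_dyadicAnnulus {j : ℤ} {y : Euc n} :
    y ∈ dyadicAnnulus n j ↔ ‖y‖ ∈ Ico ((2 : ℝ) ^ j) (2 ^ (j + 1)) := by
  rw [zpow_add_one₀ (by norm_num), mul_comm]
  simp [dyadicAnnulus, and_comm]

lemma measurableSet_dyadicAnnulus (j : ℤ) : MeasurableSet (dyadicAnnulus n j) :=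
  measurableSet_ball.diff measurableSet_ball

lemma eq_of_mem_Ico_zpow {t : ℝ} {i j : ℤ} (hi : t ∈ Ico ((2 : ℝ) ^ i) (2 ^ (i + 1)))
    (hj : t ∈ Ico ((2 : ℝ) ^ j) (2 ^ (j + 1))) : i = j := by
  have h1 := (zpow_lt_zpow_iff_right₀ (by norm_num : (1 : ℝ) < 2)).1 (hi.1.trans_lt hj.2)
  have h2 := (zpow_lt_zpow_iff_right₀ (by norm_num : (1 : ℝ) < 2)).1 (hj.1.trans_lt hi.2)
  omega

lemma pairwise_disjoint_dyadicAnnulus :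
    Pairwise (Function.onFun Disjoint (dyadicAnnulus n)) := fun _ _ hij =>
  Set.disjoint_left.2 fun _ hi hj =>
    hij (eq_of_mem_Ico_zpow (mem_dyadicAnnulus.1 hi) (mem_dyadicAnnulus.1 hj))

lemma iUnion_dyadicAnnulus : ⋃ j, dyadicAnnulus n j = {0}ᶜ := by
  ext y
  simp only [mem_iUnion, mem_dyadicAnnulus, mem_compl_iff, mem_singleton_iff]
  constructor
  · rintro ⟨j, hj, -⟩ rfl
    rw [norm_zero] at hj
    exact absurd (zpow_pos (by norm_num : (0 : ℝ) < 2) j) (not_lt.2 hj)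
  · intro hy
    exact exists_mem_Ico_zpow (norm_pos_iff.2 hy) (by norm_num)

/-- The total variation of `μ - ν` on a dyadic annulus, as a measure. -/
def tvPiece (μ ν : Measure (Euc n)) (j : ℤ) : Measure (Euc n) :=
  (μ.restrict (dyadicAnnulus n j) - ν.restrict (dyadicAnnulus n j)) +
    (ν.restrict (dyadicAnnulus n j) - μ.restrict (dyadicAnnulus n j))

lemma tvPiece_comm (μ ν : Measure (Euc n)) (j : ℤ) : tvPiece μ ν j = tvPiece ν μ j := add_comm _ _

/-- The total variation of `μ - ν` off the origin, as a measure. -/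
def tvMeasure (μ ν : Measure (Euc n)) : Measure (Euc n) := Measure.sum (tvPiece μ ν)

lemma tvMeasure_comm (μ ν : Measure (Euc n)) : tvMeasure μ ν = tvMeasure ν μ := by
  simp only [tvMeasure, funext (tvPiece_comm μ ν)]

lemma tvPiece_eq_zero {μ ν : Measure (Euc n)} {j : ℤ} {A : Set (Euc n)} (hA : MeasurableSet A)
    (h : Disjoint A (dyadicAnnulus n j)) : tvPiece μ ν j A = 0 := by
  have h1 : ∀ μ ν : Measure (Euc n),
      (μ.restrict (dyadicAnnulus n j) - ν.restrict (dyadicAnnulus n j)) A = 0 := fun μ ν =>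
    le_antisymm ((Measure.sub_le A).trans
      (by rw [Measure.restrict_apply hA, h.inter_eq, measure_empty])) bot_le
  simp [tvPiece, h1]

lemma restrict_compl_zero_le {μ ν : Measure (Euc n)}
    (hμ : ∀ j, μ (dyadicAnnulus n j) < ∞) (hν : ∀ j, ν (dyadicAnnulus n j) < ∞) :
    μ.restrict {0}ᶜ ≤ ν.restrict {0}ᶜ + tvMeasure μ ν := by
  rw [← iUnion_dyadicAnnulus,
    Measure.restrict_iUnion pairwise_disjoint_dyadicAnnulus measurableSet_dyadicAnnulus,
    Measure.restrict_iUnion pairwise_disjoint_dyadicAnnulus measurableSet_dyadicAnnulus]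
  refine Measure.le_iff.2 fun A hA => ?_
  rw [Measure.add_apply, tvMeasure, Measure.sum_apply _ hA, Measure.sum_apply _ hA,
    Measure.sum_apply _ hA, ← ENNReal.tsum_add]
  refine ENNReal.tsum_le_tsum fun j => ?_
  have : IsFiniteMeasure (μ.restrict (dyadicAnnulus n j)) := ⟨by simpa using hμ j⟩
  have : IsFiniteMeasure (ν.restrict (dyadicAnnulus n j)) := ⟨by simpa using hν j⟩
  refine (measure_le_sub_add (μ.restrict (dyadicAnnulus n j))
    (ν.restrict (dyadicAnnulus n j)) A).trans ?_
  rw [Measure.add_apply, tvPiece, Measure.add_apply, add_comm]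
  gcongr
  exact le_self_add

lemma tvMeasure_dyadicBound {s η : ℝ} (hs : 0 < s) (hη : 0 ≤ η) {μ ν : Measure (Euc n)}
    (h : ∀ ρ : ℝ, 0 < ρ →
      tvDiff μ ν (ball 0 (2 * ρ) \ ball 0 ρ) ≤ ENNReal.ofReal (η * ρ ^ (-(2 * s)))) :
    DyadicBound s (2 * 2 ^ (2 * s) * η) (tvMeasure μ ν) := by
  have hpiece : ∀ j : ℤ, tvPiece μ ν j univ ≤ ENNReal.ofReal (η * ((2 : ℝ) ^ j) ^ (-(2 * s))) :=
    fun j => h (2 ^ j) (by positivity)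
  constructor
  · rw [tvMeasure, Measure.sum_apply _ (measurableSet_singleton _), ENNReal.tsum_eq_zero]
    intro j
    refine tvPiece_eq_zero (measurableSet_singleton _) (disjoint_singleton_left.2 fun h0 => ?_)
    have : (0 : Euc n) ∈ ({0}ᶜ : Set (Euc n)) := iUnion_dyadicAnnulus ▸ mem_iUnion.2 ⟨j, h0⟩
    exact this rfl
  · intro ρ hρ
    obtain ⟨j, hj1, hj2⟩ := exists_mem_Ico_zpow hρ (by norm_num : (1 : ℝ) < 2)
    have hA : MeasurableSet (ball (0 : Euc n) (2 * ρ) \ ball 0 ρ) :=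
      measurableSet_ball.diff measurableSet_ball
    rw [tvMeasure, Measure.sum_apply _ hA, tsum_eq_sum (s := {j, j + 1}) ?_]
    · rw [Finset.sum_pair (by omega)]
      have hb : ∀ i : ℤ, j ≤ i → tvPiece μ ν i (ball 0 (2 * ρ) \ ball 0 ρ) ≤
          ENNReal.ofReal (2 ^ (2 * s) * η * ρ ^ (-(2 * s))) := fun i hi => by
        refine (measure_mono (subset_univ _)).trans ((hpiece i).trans ?_)
        refine ENNReal.ofReal_le_ofReal ?_
        have h1 : ρ / 2 ≤ (2 : ℝ) ^ i := by
          have := zpow_le_zpow_right₀ (by norm_num : (1 : ℝ) ≤ 2) hi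
          rw [zpow_add_one₀ (by norm_num)] at hj2
          linarith
        have h2 : ((2 : ℝ) ^ i) ^ (-(2 * s)) ≤ (ρ / 2) ^ (-(2 * s)) :=
          Real.rpow_le_rpow_of_nonpos (by positivity) h1 (by linarith)
        have h3 : (ρ / 2) ^ (-(2 * s)) = 2 ^ (2 * s) * ρ ^ (-(2 * s)) := by
          rw [Real.div_rpow hρ.le (by norm_num), Real.rpow_neg (by norm_num : (0 : ℝ) ≤ 2)]
          field_simp
        rw [h3] at h2
        calc _ ≤ η * (2 ^ (2 * s) * ρ ^ (-(2 * s))) := by gcongr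
          _ = _ := by ring
      refine (add_le_add (hb j le_rfl) (hb (j + 1) (by omega))).trans (le_of_eq ?_)
      rw [← ENNReal.ofReal_add (by positivity) (by positivity)]
      congr 1; ring
    · intro i hi
      refine tvPiece_eq_zero hA (Set.disjoint_left.2 fun y hy hyi => hi ?_)
      have hy1 : ‖y‖ < 2 * ρ := by simpa using hy.1
      have hy2 : ρ ≤ ‖y‖ := by simpa using hy.2
      have hyi := mem_dyadicAnnulus.1 hyi
      have l1 := (zpow_lt_zpow_iff_right₀ (by norm_num : (1 : ℝ) < 2)).1
        ((hj1.trans hy2).trans_lt hyi.2)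
      have l2 : (2 : ℝ) ^ i < 2 ^ (j + 1 + 1) := by
        rw [zpow_add_one₀ (by norm_num) (j + 1)]
        linarith [hyi.1]
      have l2 := (zpow_lt_zpow_iff_right₀ (by norm_num : (1 : ℝ) < 2)).1 l2
      rw [Finset.mem_insert, Finset.mem_singleton]
      omega

lemma integral_le_add_of_le {X : Type*} [MeasurableSpace X] {μ ν θ : Measure X} (h : μ ≤ ν + θ)
    {F : X → ℝ} (hF : 0 ≤ F) (hν : Integrable F ν) (hθ : Integrable F θ) :
    ∫ y, F y ∂μ ≤ (∫ y, F y ∂ν) + ∫ y, F y ∂θ := by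
  rw [← integral_add_measure hν hθ]
  exact integral_mono_measure h (ae_of_all _ hF) (hν.add_measure hθ)

lemma abs_integral_sub_integral_le {X : Type*} [MeasurableSpace X] {μ ν θ : Measure X}
    (h : μ ≤ ν + θ) (h' : ν ≤ μ + θ) {F : X → ℝ} (hμ : Integrable F μ) (hν : Integrable F ν)
    (hθ : Integrable F θ) :
    |(∫ y, F y ∂μ) - ∫ y, F y ∂ν| ≤ ∫ y, |F y| ∂θ := by
  have e : ∀ m : Measure X, Integrable F m →
      ∫ y, F y ∂m = (∫ y, max (F y) 0 ∂m) - ∫ y, max (-F y) 0 ∂m := fun m hm => by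
    rw [← integral_sub hm.pos_part hm.neg_part]
    congr 1; ext y
    rcases le_total (F y) 0 with h | h <;> simp [h]
  have e' : ∫ y, |F y| ∂θ = (∫ y, max (F y) 0 ∂θ) + ∫ y, max (-F y) 0 ∂θ := by
    rw [← integral_add hθ.pos_part hθ.neg_part]
    congr 1; ext y
    rcases le_total (F y) 0 with h | h <;> simp [h, abs_of_nonpos, abs_of_nonneg]
  have p1 := integral_le_add_of_le h (F := fun y => max (F y) 0) (fun y => le_max_right _ _)
    hν.pos_part hθ.pos_part
  have p2 := integral_le_add_of_le h (F := fun y => max (-F y) 0) (fun y => le_max_right _ _)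
    hν.neg_part hθ.neg_part
  have p3 := integral_le_add_of_le h' (F := fun y => max (F y) 0) (fun y => le_max_right _ _)
    hμ.pos_part hθ.pos_part
  have p4 := integral_le_add_of_le h' (F := fun y => max (-F y) 0) (fun y => le_max_right _ _)
    hμ.neg_part hθ.neg_part
  rw [e μ hμ, e ν hν, e', abs_le]
  constructor <;> linarith

lemma integral_abs_le_of_le_jumpWeight {s β M r c : ℝ} {m : Measure (Euc n)} (hM : 0 ≤ M)
    (h : DyadicBound s M m) (hβ : 0 < β) (h1 : 2 * s < β + 1) (h2 : β < 2 * s) (hr : 0 < r)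
    (hc : 0 ≤ c) {F : Euc n → ℝ} (hFc : ∀ y, |F y| ≤ c * jumpWeight β r y) :
    ∫ y, |F y| ∂m ≤ c * (weightConst s β * M * r ^ (β - 2 * s)) := by
  have hw := weightConst_pos h1 h2
  have hi : Integrable (jumpWeight β r) m := by
    refine integrable_of_le_jumpWeight (c := 1) hM h hβ h1 h2 hr
      measurable_jumpWeight.aestronglyMeasurable fun y => ?_
    rw [one_mul, abs_of_nonneg (jumpWeight_nonneg hr y)]
  calc ∫ y, |F y| ∂m ≤ ∫ y, c * jumpWeight β r y ∂m :=
        integral_mono_of_nonneg (ae_of_all _ fun y => abs_nonneg _) (hi.const_mul c)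
          (ae_of_all _ hFc)
    _ = c * ∫ y, jumpWeight β r y ∂m := integral_const_mul _ _
    _ ≤ _ := by
        gcongr
        rw [integral_eq_lintegral_of_nonneg_ae (ae_of_all _ (jumpWeight_nonneg hr))
          measurable_jumpWeight.aestronglyMeasurable]
        exact ENNReal.toReal_le_of_le_ofReal (by positivity)
          (lintegral_jumpWeight_le hM h hβ h1 h2 hr)

/-- Measures that are close in total variation on annuli give close integrals. -/
lemma abs_integral_sub_le_of_tvDiff {s η β M r c : ℝ} (hs : 0 < s) (hη : 0 ≤ η) (hM : 0 ≤ M)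
    {μ ν : Measure (Euc n)} (hβ : 0 < β) (h1 : 2 * s < β + 1) (h2 : β < 2 * s) (hr : 0 < r)
    (h : ∀ ρ : ℝ, 0 < ρ →
      tvDiff μ ν (ball 0 (2 * ρ) \ ball 0 ρ) ≤ ENNReal.ofReal (η * ρ ^ (-(2 * s))))
    (hμ : DyadicBound s M (μ.restrict {0}ᶜ)) (hν : DyadicBound s M (ν.restrict {0}ᶜ))
    (hc : 0 ≤ c) {F : Euc n → ℝ} (hF : Measurable F)
    (hFc : ∀ y, |F y| ≤ c * jumpWeight β r y) :
    |(∫ y, F y ∂(μ.restrict {0}ᶜ)) - ∫ y, F y ∂(ν.restrict {0}ᶜ)| ≤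
      c * (weightConst s β * (2 * 2 ^ (2 * s) * η) * r ^ (β - 2 * s)) := by
  have hfin : ∀ μ : Measure (Euc n), DyadicBound s M (μ.restrict {0}ᶜ) →
      ∀ j, μ (dyadicAnnulus n j) < ∞ := fun μ hμ j => by
    have h3 : μ.restrict {0}ᶜ (dyadicAnnulus n j) ≤ _ := hμ.2 (2 ^ j) (by positivity)
    rw [Measure.restrict_apply (measurableSet_dyadicAnnulus j), inter_eq_left.2] at h3
    · exact h3.trans_lt ENNReal.ofReal_lt_top
    · rw [← iUnion_dyadicAnnulus]
      exact subset_iUnion (dyadicAnnulus n) j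
  have hθ := tvMeasure_dyadicBound hs hη h
  have le1 := restrict_compl_zero_le (hfin μ hμ) (hfin ν hν)
  have le2 := restrict_compl_zero_le (hfin ν hν) (hfin μ hμ)
  rw [tvMeasure_comm ν μ] at le2
  refine (abs_integral_sub_integral_le le1 le2
    (integrable_of_le_jumpWeight hM hμ hβ h1 h2 hr hF.aestronglyMeasurable hFc)
    (integrable_of_le_jumpWeight hM hν hβ h1 h2 hr hF.aestronglyMeasurable hFc)
    (integrable_of_le_jumpWeight (by positivity) hθ hβ h1 h2 hr hF.aestronglyMeasurable hFc)).trans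
    ?_
  exact integral_abs_le_of_le_jumpWeight (by positivity) hθ hβ h1 h2 hr hc hFc

/-- The jump measure of `K` at `x`, recentred at the origin. -/
def centered (K : Euc n → Measure (Euc n)) (x : Euc n) : Measure (Euc n) :=
  (Measure.map (fun z => z - x) (K x)).restrict {0}ᶜ

lemma centered_dyadicBound {s lam Lam : ℝ} {K : Euc n → Measure (Euc n)}
    (hK : DivElliptic s lam Lam K) (x : Euc n) : DyadicBound s Lam (centered K x) := by
  refine ⟨by simp [centered], fun ρ hρ => ?_⟩
  have hpos : 0 < ρ ^ (2 * s) := by positivity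
  have h := hK.1 x ρ hρ
  have hset : (fun z => z - x) ⁻¹' (ball 0 (2 * ρ) \ ball 0 ρ) = ball x (2 * ρ) \ ball x ρ := by
    ext z; simp [dist_eq_norm]
  calc centered K x (ball 0 (2 * ρ) \ ball 0 ρ)
      ≤ Measure.map (fun z => z - x) (K x) (ball 0 (2 * ρ) \ ball 0 ρ) :=
        Measure.restrict_apply_le _ _
    _ = K x (ball x (2 * ρ) \ ball x ρ) := by
        rw [Measure.map_apply (by fun_prop) (measurableSet_ball.diff measurableSet_ball), hset]
    _ ≤ ENNReal.ofReal Lam / ENNReal.ofReal (ρ ^ (2 * s)) := by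
        rw [ENNReal.le_div_iff_mul_le (Or.inl (by simpa using hpos))
          (Or.inl ENNReal.ofReal_ne_top), mul_comm]
        exact h
    _ = ENNReal.ofReal (Lam * ρ ^ (-(2 * s))) := by
        rw [← ENNReal.ofReal_div_of_pos hpos, Real.rpow_neg hρ.le, div_eq_mul_inv]

lemma measure_compl_ball_le {s lam Lam : ℝ} {K : Euc n → Measure (Euc n)} (hs : 0 < s)
    (hLam : 0 ≤ Lam) (hK : DivElliptic s lam Lam K) (x : Euc n) {r : ℝ} (hr : 0 < r) :
    K x (ball x r)ᶜ ≤ ENNReal.ofReal (geomConst (2 * s) * (Lam * r ^ (-(2 * s)))) := by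
  refine le_trans (le_of_eq ?_) ((centered_dyadicBound hK x).measure_compl_ball_le hs hLam hr)
  have hsub : (ball (0 : Euc n) r)ᶜ ⊆ {0}ᶜ := by
    rw [compl_subset_compl, singleton_subset_iff]
    exact mem_ball_self hr
  rw [centered, Measure.restrict_apply measurableSet_ball.compl, inter_eq_left.2 hsub,
    Measure.map_apply (by fun_prop) measurableSet_ball.compl]
  congr 1
  ext z; simp [dist_eq_norm]

/-- First factors of a countable cover of the off-diagonal set by rectangles. -/
def coverFst (n : ℕ) (i : ℕ) : Set (Euc n) :=
  ball (TopologicalSpace.denseSeq (Euc n) i.unpair.1) (1 / ((i.unpair.2 : ℝ) + 1))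

/-- Second factors of a countable cover of the off-diagonal set by rectangles. -/
def coverSnd (n : ℕ) (i : ℕ) : Set (Euc n) :=
  (ball (TopologicalSpace.denseSeq (Euc n) i.unpair.1) (2 * (1 / ((i.unpair.2 : ℝ) + 1))))ᶜ

lemma disjoint_cover (i : ℕ) : Disjoint (coverFst n i) (coverSnd n i) := by
  have : (0 : ℝ) < 1 / ((i.unpair.2 : ℝ) + 1) := by positivity
  exact disjoint_compl_right_iff_subset.2 (ball_subset_ball (by linarith))

lemma coverSnd_subset {i : ℕ} {x : Euc n} (hx : x ∈ coverFst n i) :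
    coverSnd n i ⊆ (ball x (1 / ((i.unpair.2 : ℝ) + 1)))ᶜ := by
  rw [coverSnd, compl_subset_compl]
  refine ball_subset_ball' ?_
  have : dist x _ < _ := hx
  linarith

lemma iUnion_cover : ⋃ i, coverFst n i ×ˢ coverSnd n i = {p | p.1 ≠ p.2} := by
  ext ⟨x, z⟩
  simp only [mem_iUnion, mem_prod, mem_ofPred_eq]
  constructor
  · rintro ⟨i, hx, hz⟩ rfl
    exact Set.disjoint_left.1 (disjoint_cover i) hx hz
  · intro hxz
    obtain ⟨m, hm⟩ := exists_nat_one_div_lt (show 0 < dist x z / 3 by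
      have := dist_pos.2 hxz; linarith)
    obtain ⟨d, hd⟩ := (TopologicalSpace.denseRange_denseSeq (Euc n)).exists_dist_lt x
      (show (0 : ℝ) < 1 / ((m : ℝ) + 1) by positivity)
    refine ⟨Nat.pair d m, ?_, ?_⟩
    · simpa [coverFst] using hd
    · simp only [coverSnd, Nat.unpair_pair, mem_compl_iff, mem_ball, not_lt]
      have := dist_triangle_right x z (TopologicalSpace.denseSeq (Euc n) d)
      linarith

open ProbabilityTheory in
lemma exists_sFinite_kernel {s lam Lam : ℝ} {K : Euc n → Measure (Euc n)} (hs : 0 < s)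
    (hLam : 0 ≤ Lam) (hKm : MeasKernel K) (hK : DivElliptic s lam Lam K) :
    ∃ k : Kernel (Euc n) (Euc n), IsSFiniteKernel k ∧ ∀ x, k x = (K x).restrict {x}ᶜ := by
  classical
  let k₀ : Kernel (Euc n) (Euc n) := ⟨K, Measure.measurable_of_measurable_coe K hKm⟩
  have hA : ∀ i, MeasurableSet (coverFst n i) := fun i => measurableSet_ball
  have hB : ∀ i, MeasurableSet (coverSnd n i) := fun i => measurableSet_ball.compl
  let R : ℕ → Set (Euc n × Euc n) := fun i => coverFst n i ×ˢ coverSnd n i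
  have hR : ∀ i, MeasurableSet (R i) := fun i => (hA i).prod (hB i)
  let T := disjointed R
  have hT : ∀ i, MeasurableSet (T i) := fun i => MeasurableSet.disjointed hR i
  let k₁ : ℕ → Kernel (Euc n) (Euc n) := fun i =>
    Kernel.piecewise (hA i) (Kernel.restrict k₀ (hB i)) 0
  have hk₁ : ∀ i, IsFiniteKernel (k₁ i) := fun i => by
    refine ⟨ENNReal.ofReal (geomConst (2 * s) * (Lam * (1 / ((i.unpair.2 : ℝ) + 1)) ^ (-(2 * s)))),
      ENNReal.ofReal_lt_top, fun x => ?_⟩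
    simp only [k₁, Kernel.piecewise_apply]
    split_ifs with hx
    · rw [Kernel.restrict_apply, Measure.restrict_apply_univ]
      exact (measure_mono (coverSnd_subset hx)).trans
        (measure_compl_ball_le hs hLam hK x (by positivity))
    · simp
  let k₂ : ℕ → Kernel (Euc n) (Euc n) := fun i =>
    Kernel.withDensity (k₁ i) (fun x z => (T i).indicator 1 (x, z))
  have hk₂ : ∀ i, IsSFiniteKernel (k₂ i) := fun i => by
    refine Kernel.IsSFiniteKernel.withDensity _ fun x z => ?_
    by_cases h : (x, z) ∈ T i <;> simp [h]
  refine ⟨Kernel.sum k₂, inferInstance, fun x => ?_⟩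
  have hsec : ∀ i, k₂ i x = (K x).restrict (Prod.mk x ⁻¹' T i) := fun i => by
    have hm : MeasurableSet (Prod.mk x ⁻¹' T i) := measurable_prodMk_left (hT i)
    have hmeas : Measurable (Function.uncurry fun (x z : Euc n) =>
        (T i).indicator (1 : Euc n × Euc n → ℝ≥0∞) (x, z)) := by
      exact measurable_one.indicator (hT i)
    simp only [k₂]
    rw [Kernel.withDensity_apply _ hmeas]
    have e : (fun z => (T i).indicator (1 : Euc n × Euc n → ℝ≥0∞) (x, z)) =
        (Prod.mk x ⁻¹' T i).indicator 1 := rfl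
    rw [e, withDensity_indicator_one hm]
    simp only [k₁, Kernel.piecewise_apply]
    have hTR : T i ⊆ R i := disjointed_subset R i
    split_ifs with hx
    · rw [Kernel.restrict_apply, Measure.restrict_restrict hm, inter_eq_left.2]
      · rfl
      · exact fun z hz => (hTR hz).2
    · have : Prod.mk x ⁻¹' T i = ∅ := by
        ext z
        simp only [mem_preimage, mem_empty_iff_false, iff_false]
        exact fun hz => hx (hTR hz).1
      simp [this]
  rw [Kernel.sum_apply]
  simp_rw [hsec]
  rw [← Measure.restrict_iUnion]
  · congr 1
    rw [← preimage_iUnion, iUnion_disjointed, iUnion_cover]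
    ext z
    simp [eq_comm]
  · intro i j hij
    exact (disjoint_disjointed R hij).preimage _
  · exact fun i => measurable_prodMk_left (hT i)

open ProbabilityTheory in
lemma map_swap_compProd {s lam Lam : ℝ} {K : Euc n → Measure (Euc n)} (hs : 0 < s)
    (hLam : 0 ≤ Lam) (hKs : DivSymmetric K) (hK : DivElliptic s lam Lam K)
    (k : Kernel (Euc n) (Euc n)) [IsSFiniteKernel k] (hk : ∀ x, k x = (K x).restrict {x}ᶜ) :
    Measure.map Prod.swap ((volume : Measure (Euc n)).compProd k) =
      (volume : Measure (Euc n)).compProd k := by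
  set m := (volume : Measure (Euc n)).compProd k with hm
  have hdiag : MeasurableSet {p : Euc n × Euc n | p.1 = p.2} := measurableSet_diagonal
  have rect : ∀ A B : Set (Euc n), MeasurableSet A → MeasurableSet B → Disjoint A B →
      m (A ×ˢ B) = ∫⁻ x in A, K x B := fun A B hA hB hAB => by
    rw [hm, Measure.compProd_apply_prod hA hB]
    refine setLIntegral_congr_fun hA fun x hx => ?_
    simp only [hk x]
    rw [Measure.restrict_apply hB, inter_eq_left.2]
    exact fun z hz h => Set.disjoint_left.1 hAB hx (by rw [mem_singleton_iff] at h; rwa [← h])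
  have hd0 : m {p : Euc n × Euc n | p.1 = p.2} = 0 := by
    rw [hm, Measure.compProd_apply hdiag]
    refine lintegral_eq_zero_of_ae_eq_zero (ae_of_all _ fun x => ?_)
    have : Prod.mk x ⁻¹' {p : Euc n × Euc n | p.1 = p.2} = {x} := by ext z; simp [eq_comm]
    change k x (Prod.mk x ⁻¹' {p : Euc n × Euc n | p.1 = p.2}) = 0
    rw [this, hk x]
    simp
  have hswap : ∀ S : Set (Euc n × Euc n), MeasurableSet S →
      Measure.map Prod.swap m S = m (Prod.swap ⁻¹' S) := fun S hS =>
    Measure.map_apply measurable_swap hS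
  have hA : ∀ i, MeasurableSet (coverFst n i) := fun i => measurableSet_ball
  have hB : ∀ i, MeasurableSet (coverSnd n i) := fun i => measurableSet_ball.compl
  rw [Measure.ext_iff_of_iUnion_eq_univ
    (s := fun o : Option ℕ => o.elim {p : Euc n × Euc n | p.1 = p.2}
      fun i => coverFst n i ×ˢ coverSnd n i)]
  · rintro (_ | i)
    · simp only [Option.elim]
      rw [Measure.restrict_eq_zero.2 hd0, Measure.restrict_eq_zero, hswap _ hdiag]
      rw [← hd0]
      congr 1; ext p; simp [eq_comm]
    · simp only [Option.elim]
      have hfin : m (coverFst n i ×ˢ coverSnd n i) < ∞ := by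
        rw [rect _ _ (hA i) (hB i) (disjoint_cover i)]
        refine (setLIntegral_mono' (hA i) fun x hx =>
          (measure_mono (coverSnd_subset hx)).trans
            (measure_compl_ball_le hs hLam hK x (by positivity))).trans_lt ?_
        rw [setLIntegral_const]
        exact ENNReal.mul_lt_top ENNReal.ofReal_lt_top measure_ball_lt_top
      have key : ∀ S T : Set (Euc n), MeasurableSet S → MeasurableSet T →
          (Measure.map Prod.swap m) ((S ×ˢ T) ∩ coverFst n i ×ˢ coverSnd n i) =
            m ((S ×ˢ T) ∩ coverFst n i ×ˢ coverSnd n i) := fun S T hS hT => by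
        have hd : Disjoint (S ∩ coverFst n i) (T ∩ coverSnd n i) :=
          (disjoint_cover i).mono inter_subset_right inter_subset_right
        rw [prod_inter_prod, hswap _ ((hS.inter (hA i)).prod (hT.inter (hB i))),
          preimage_swap_prod, rect _ _ (hT.inter (hB i)) (hS.inter (hA i)) hd.symm,
          rect _ _ (hS.inter (hA i)) (hT.inter (hB i)) hd]
        exact hKs _ _ (hT.inter (hB i)) (hS.inter (hA i)) hd.symm
      have : IsFiniteMeasure (m.restrict (coverFst n i ×ˢ coverSnd n i)) :=
        ⟨by rwa [Measure.restrict_apply_univ]⟩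
      symm
      refine Measure.ext_prod fun {S T} hS hT => ?_
      rw [Measure.restrict_apply (hS.prod hT), Measure.restrict_apply (hS.prod hT), key S T hS hT]
  · rw [iUnion_option]
    simp only [Option.elim]
    rw [iUnion_cover]
    ext p
    simp [em]

/-- The integrand of the symmetrised weak formulation, tested with `ψ` at scale `r`. -/
def weakIntegrand (u ψ : Euc n → ℝ) (r : ℝ) (x y : Euc n) : ℝ :=
  if ‖y‖ < r then 1 / 2 * ((u x - u (x + y)) * (ψ x - ψ (x + y))) else (u x - u (x + y)) * ψ x

/-- `ψ` is a bump of height `A` and Lipschitz constant `A / r` supported in `ball p r`. -/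
structure IsBump (A r : ℝ) (p : Euc n) (ψ : Euc n → ℝ) : Prop where
  contDiff : ContDiff ℝ (⊤ : ℕ∞) ψ
  abs_le : ∀ x, |ψ x| ≤ A
  lipschitz : ∀ x z, |ψ x - ψ z| ≤ A * r⁻¹ * ‖x - z‖
  eq_zero : ∀ x, x ∉ ball p r → ψ x = 0

lemma IsBump.nonneg {A r : ℝ} {p : Euc n} {ψ : Euc n → ℝ} (h : IsBump A r p ψ) : 0 ≤ A :=
  (abs_nonneg _).trans (h.abs_le 0)

lemma abs_weakIntegrand_le {A H β r : ℝ} {p : Euc n} {u ψ : Euc n → ℝ} (hH : 0 ≤ H) (hβ : 0 < β)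
    (hu : ∀ x y, |u x - u y| ≤ H * ‖x - y‖ ^ β) (hψ : IsBump A r p ψ) (x y : Euc n) :
    |weakIntegrand u ψ r x y| ≤ A * H * jumpWeight β r y := by
  have hA := hψ.nonneg
  have h1 : |u x - u (x + y)| ≤ H * ‖y‖ ^ β := by simpa using hu x (x + y)
  unfold weakIntegrand jumpWeight
  split_ifs with h
  · have h2 : |ψ x - ψ (x + y)| ≤ A * r⁻¹ * ‖y‖ := by simpa using hψ.lipschitz x (x + y)
    rw [Real.rpow_add_one' (norm_nonneg _) (by linarith), abs_mul, abs_mul]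
    calc |(1 / 2 : ℝ)| * (|u x - u (x + y)| * |ψ x - ψ (x + y)|)
        ≤ 1 * ((H * ‖y‖ ^ β) * (A * r⁻¹ * ‖y‖)) := by
          gcongr
          rw [abs_of_pos] <;> norm_num
      _ = _ := by ring
  · rw [abs_mul]
    calc |u x - u (x + y)| * |ψ x| ≤ (H * ‖y‖ ^ β) * A := by
          gcongr
          exact hψ.abs_le x
      _ = _ := by ring

lemma weakIntegrand_eq_zero {A r : ℝ} {p : Euc n} {u ψ : Euc n → ℝ} (hr : 0 < r)
    (hψ : IsBump A r p ψ) {x : Euc n} (hx : x ∉ ball p (2 * r)) (y : Euc n) :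
    weakIntegrand u ψ r x y = 0 := by
  have hx' : ψ x = 0 := hψ.eq_zero x fun h => hx (ball_subset_ball (by linarith) h)
  unfold weakIntegrand
  split_ifs with h
  · have : ψ (x + y) = 0 := hψ.eq_zero _ fun h' => hx <| by
      rw [mem_ball, dist_eq_norm] at h' ⊢
      calc ‖x - p‖ = ‖(x + y - p) - y‖ := by congr 1; abel
        _ ≤ ‖x + y - p‖ + ‖y‖ := norm_sub_le _ _
        _ < 2 * r := by linarith
    simp [hx', this]
  · simp [hx']

lemma centered_eq_map {K : Euc n → Measure (Euc n)} {k : ProbabilityTheory.Kernel (Euc n) (Euc n)}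
    (hk : ∀ x, k x = (K x).restrict {x}ᶜ) (x : Euc n) :
    centered K x = Measure.map (fun z => z - x) (k x) := by
  rw [centered, Measure.restrict_map (by fun_prop) (measurableSet_singleton _).compl, hk]
  congr 2
  ext z; simp [sub_eq_zero]

lemma integral_centered {K : Euc n → Measure (Euc n)} {k : ProbabilityTheory.Kernel (Euc n) (Euc n)}
    (hk : ∀ x, k x = (K x).restrict {x}ᶜ) (x : Euc n) (F : Euc n → ℝ) :
    ∫ y, F y ∂(centered K x) = ∫ z, F (z - x) ∂(k x) := by
  rw [centered_eq_map hk]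
  exact integral_map_equiv (MeasurableEquiv.subRight x) F

lemma lintegral_centered {K : Euc n → Measure (Euc n)}
    {k : ProbabilityTheory.Kernel (Euc n) (Euc n)}
    (hk : ∀ x, k x = (K x).restrict {x}ᶜ) (x : Euc n) (F : Euc n → ℝ≥0∞) :
    ∫⁻ y, F y ∂(centered K x) = ∫⁻ z, F (z - x) ∂(k x) := by
  rw [centered_eq_map hk]
  exact lintegral_map_equiv F (MeasurableEquiv.subRight x)

lemma integrable_compProd_of_le_jumpWeight {s lam Lam β r c : ℝ} {K : Euc n → Measure (Euc n)}
    (hLam : 0 ≤ Lam) (hK : DivElliptic s lam Lam K) {k : ProbabilityTheory.Kernel (Euc n) (Euc n)}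
    [ProbabilityTheory.IsSFiniteKernel k] (hk : ∀ x, k x = (K x).restrict {x}ᶜ) (hβ : 0 < β)
    (h1 : 2 * s < β + 1)
    (h2 : β < 2 * s) (hr : 0 < r) (hc : 0 ≤ c) (p : Euc n) {F : Euc n × Euc n → ℝ}
    (hF : Measurable F) (hFc : ∀ q : Euc n × Euc n, |F q| ≤ c * jumpWeight β r (q.2 - q.1))
    (hF0 : ∀ q : Euc n × Euc n, q.1 ∉ ball p (2 * r) → F q = 0) :
    Integrable F ((volume : Measure (Euc n)).compProd k) := by
  refine ⟨hF.aestronglyMeasurable, ?_⟩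
  rw [HasFiniteIntegral, Measure.lintegral_compProd hF.enorm]
  have hin : ∀ x, ∫⁻ z, ‖F (x, z)‖ₑ ∂(k x) ≤
      ENNReal.ofReal c * ENNReal.ofReal (weightConst s β * Lam * r ^ (β - 2 * s)) := fun x =>
    calc ∫⁻ z, ‖F (x, z)‖ₑ ∂(k x)
        ≤ ∫⁻ z, ENNReal.ofReal c * ENNReal.ofReal (jumpWeight β r (z - x)) ∂(k x) := by
          refine lintegral_mono fun z => ?_
          rw [Real.enorm_eq_ofReal_abs, ← ENNReal.ofReal_mul hc]
          exact ENNReal.ofReal_le_ofReal (hFc (x, z))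
      _ = ENNReal.ofReal c * ∫⁻ y, ENNReal.ofReal (jumpWeight β r y) ∂(centered K x) := by
          rw [lintegral_centered hk, lintegral_const_mul']
          exact ENNReal.ofReal_ne_top
      _ ≤ _ := by
          gcongr
          exact lintegral_jumpWeight_le hLam (centered_dyadicBound hK x) hβ h1 h2 hr
  calc ∫⁻ x, ∫⁻ z, ‖F (x, z)‖ₑ ∂(k x)
      ≤ ∫⁻ x, (ball p (2 * r)).indicator (fun _ => ENNReal.ofReal c *
          ENNReal.ofReal (weightConst s β * Lam * r ^ (β - 2 * s))) x := by
        refine lintegral_mono fun x => ?_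
        by_cases hx : x ∈ ball p (2 * r)
        · rw [indicator_of_mem hx]; exact hin x
        · rw [indicator_of_notMem hx]
          simp [fun z => hF0 (x, z) hx]
    _ < ∞ := by
        rw [lintegral_indicator measurableSet_ball, setLIntegral_const]
        exact ENNReal.mul_lt_top (ENNReal.mul_lt_top ENNReal.ofReal_lt_top ENNReal.ofReal_lt_top)
          measure_ball_lt_top

lemma measurable_weakIntegrand_sub {u ψ : Euc n → ℝ} {r : ℝ} (hu : Continuous u)
    (hψ : Continuous ψ) :
    Measurable fun q : Euc n × Euc n => weakIntegrand u ψ r q.1 (q.2 - q.1) := by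
  unfold weakIntegrand
  refine Measurable.ite (measurableSet_lt (by fun_prop) measurable_const) ?_ ?_
  · exact Continuous.measurable (by fun_prop)
  · exact Continuous.measurable (by fun_prop)

lemma half_integral_eq_weakIntegrand {s lam Lam β r A H : ℝ} {K : Euc n → Measure (Euc n)}
    {p : Euc n} {u ψ : Euc n → ℝ} (hs : 0 < s)
    (hLam : 0 ≤ Lam) (hKm : MeasKernel K) (hKs : DivSymmetric K) (hK : DivElliptic s lam Lam K)
    (hβ : 0 < β) (h1 : 2 * s < β + 1) (h2 : β < 2 * s) (hr : 0 < r) (hH : 0 ≤ H)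
    (huc : Continuous u) (hu : ∀ x y, |u x - u y| ≤ H * ‖x - y‖ ^ β) (hψ : IsBump A r p ψ) :
    Integrable (fun x => ∫ y, weakIntegrand u ψ r x y ∂(centered K x)) ∧
      1 / 2 * (∫ x, ∫ z, (u x - u z) * (ψ x - ψ z) ∂(K x)) =
        ∫ x, ∫ y, weakIntegrand u ψ r x y ∂(centered K x) := by
  obtain ⟨k, hkf, hk⟩ := exists_sFinite_kernel hs hLam hKm hK
  have hsw := map_swap_compProd hs hLam hKs hK k hk
  set m := (volume : Measure (Euc n)).compProd k with hm
  have hψc := hψ.contDiff.continuous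
  let G : Euc n × Euc n → ℝ := fun q => weakIntegrand u ψ r q.1 (q.2 - q.1)
  let G₂ : Euc n × Euc n → ℝ := fun q => if ‖q.2 - q.1‖ < r then 0 else G q
  have hG : Measurable G := measurable_weakIntegrand_sub huc hψc
  have hG₂ : Measurable G₂ :=
    Measurable.ite (measurableSet_lt (by fun_prop) measurable_const) measurable_const hG
  have hGb : ∀ q, |G q| ≤ A * H * jumpWeight β r (q.2 - q.1) := fun q =>
    abs_weakIntegrand_le hH hβ hu hψ _ _
  have hG0 : ∀ q : Euc n × Euc n, q.1 ∉ ball p (2 * r) → G q = 0 := fun q hq =>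
    weakIntegrand_eq_zero hr hψ hq _
  have hA := hψ.nonneg
  have hGi : Integrable G m := integrable_compProd_of_le_jumpWeight hLam hK hk hβ h1 h2 hr
    (by positivity) p hG hGb hG0
  have hG₂i : Integrable G₂ m := by
    refine integrable_compProd_of_le_jumpWeight (c := A * H) hLam hK hk hβ h1 h2 hr
      (by positivity) p hG₂ (fun q => ?_) fun q hq => ?_
    · simp only [G₂]
      split_ifs
      · simpa using mul_nonneg (mul_nonneg hA hH) (jumpWeight_nonneg (β := β) hr (q.2 - q.1))
      · exact hGb q
    · simp only [G₂, hG0 q hq, ite_self]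
  have hG₂s : Integrable (fun q => G₂ q.swap) m := by
    exact MeasurePreserving.integrable_comp_of_integrable ⟨measurable_swap, hsw⟩ hG₂i
  have hG₂e : ∫ q, G₂ q.swap ∂m = ∫ q, G₂ q ∂m := by
    conv_rhs => rw [← hsw]
    rw [integral_map measurable_swap.aemeasurable hG₂.aestronglyMeasurable]
  have hΦ : ∀ q : Euc n × Euc n,
      (u q.1 - u q.2) * (ψ q.1 - ψ q.2) = 2 * G q - G₂ q + G₂ q.swap := fun q => by
    simp only [G, G₂, weakIntegrand, Prod.fst_swap, Prod.snd_swap, add_sub_cancel,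
      norm_sub_rev q.1 q.2]
    split_ifs <;> ring
  have hΦi : Integrable (fun q : Euc n × Euc n => (u q.1 - u q.2) * (ψ q.1 - ψ q.2)) m := by
    simp_rw [hΦ]
    exact ((hGi.const_mul 2).sub hG₂i).add hG₂s
  have hΦe : ∫ q : Euc n × Euc n, (u q.1 - u q.2) * (ψ q.1 - ψ q.2) ∂m = 2 * ∫ q, G q ∂m := by
    have h : Integrable (fun q => 2 * G q - G₂ q) m := (hGi.const_mul 2).sub hG₂i
    simp_rw [hΦ]
    rw [integral_add h hG₂s, integral_sub (hGi.const_mul 2) hG₂i, integral_const_mul, hG₂e]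
    ring
  have hKk : ∀ x, ∫ z, (u x - u z) * (ψ x - ψ z) ∂(K x) =
      ∫ z, (u x - u z) * (ψ x - ψ z) ∂(k x) := fun x => by
    rw [hk x]
    refine (setIntegral_eq_integral_of_forall_compl_eq_zero fun z hz => ?_).symm
    have : z = x := by simpa using hz
    simp [this]
  simp_rw [hKk, integral_centered hk]
  refine ⟨Integrable.integral_compProd (f := G) (κ := ProbabilityTheory.Kernel.const Unit volume)
    (η := ProbabilityTheory.Kernel.prodMkLeft Unit k) (a := ()) hGi, ?_⟩
  rw [← Measure.integral_compProd hΦi, hΦe, ← Measure.integral_compProd (f := G) hGi]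
  ring

lemma tvDiff_map_le {μ ν : Measure (Euc n)} (T : Euc n ≃ᵐ Euc n) {A : Set (Euc n)}
    (hA : MeasurableSet A) (hμ : μ (T ⁻¹' A) < ∞) (hν : ν (T ⁻¹' A) < ∞) :
    tvDiff (μ.map T) (ν.map T) A ≤ tvDiff μ ν (T ⁻¹' A) := by
  have key : ∀ μ ν : Measure (Euc n), μ (T ⁻¹' A) < ∞ → ν (T ⁻¹' A) < ∞ →
      ((μ.map T).restrict A - (ν.map T).restrict A) univ ≤
        (μ.restrict (T ⁻¹' A) - ν.restrict (T ⁻¹' A)) univ := fun μ ν hμ hν => by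
    have : IsFiniteMeasure (μ.restrict (T ⁻¹' A)) := ⟨by rwa [Measure.restrict_apply_univ]⟩
    have : IsFiniteMeasure (ν.restrict (T ⁻¹' A)) := ⟨by rwa [Measure.restrict_apply_univ]⟩
    have h : (μ.map T).restrict A - (ν.map T).restrict A ≤
        (μ.restrict (T ⁻¹' A) - ν.restrict (T ⁻¹' A)).map T := by
      refine Measure.sub_le_of_le_add ?_
      rw [Measure.restrict_map T.measurable hA, Measure.restrict_map T.measurable hA,
        ← Measure.map_add _ _ T.measurable]
      exact Measure.map_mono (measure_le_sub_add _ _) T.measurable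
    refine (h univ).trans (le_of_eq ?_)
    rw [Measure.map_apply T.measurable MeasurableSet.univ, preimage_univ]
  exact add_le_add (key μ ν hμ hν) (key ν μ hν hμ)

lemma tvDiff_centered_le {s lam Lam η : ℝ} {K : Euc n → Measure (Euc n)}
    (hK : DivElliptic s lam Lam K) (hX : XReg s 0 η K) (x x₀ : Euc n) {ρ : ℝ} (hρ : 0 < ρ) :
    tvDiff (Measure.map (fun z => z - x) (K x)) (Measure.map (fun z => z - x₀) (K x₀))
      (ball 0 (2 * ρ) \ ball 0 ρ) ≤ ENNReal.ofReal (η * ρ ^ (-(2 * s))) := by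
  have h := hX x₀ (x - x₀) ρ hρ
  rw [add_sub_cancel, Real.rpow_zero, mul_one] at h
  have hset : ∀ y : Euc n, (fun z => z - y) ⁻¹' (ball 0 (2 * ρ) \ ball 0 ρ) =
      ball y (2 * ρ) \ ball y ρ := fun y => by
    ext z; simp [dist_eq_norm]
  have hfin : ∀ y, K y (ball y (2 * ρ) \ ball y ρ) < ∞ := fun y => by
    refine lt_top_iff_ne_top.2 fun htop => ?_
    have := hK.1 y ρ hρ
    rw [htop, ENNReal.mul_top (by simpa using by positivity)] at this
    exact absurd this (by simp)
  have hA : MeasurableSet (ball (0 : Euc n) (2 * ρ) \ ball 0 ρ) :=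
    measurableSet_ball.diff measurableSet_ball
  have e : Measure.map (fun z => z - x) (K x) =
      Measure.map (fun z => z - x₀) (Measure.map (fun z => z - (x - x₀)) (K x)) := by
    rw [Measure.map_map (by fun_prop) (by fun_prop)]
    congr 1
    ext1 z
    simp only [Function.comp]
    abel
  rw [e]
  refine (tvDiff_map_le (MeasurableEquiv.subRight x₀) hA ?_ ?_).trans ?_
  · change Measure.map _ _ ((fun z => z - x₀) ⁻¹' _) < _
    rw [Measure.map_apply (by fun_prop) ((by fun_prop : Measurable fun z : Euc n => z - x₀) hA),
      ← preimage_comp]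
    have : (fun z => z - x₀) ∘ (fun z => z - (x - x₀)) = fun z => z - x := by
      ext1 z; simp only [Function.comp]; abel
    rw [this, hset]
    exact hfin x
  · change K x₀ ((fun z => z - x₀) ⁻¹' _) < _
    rw [hset]
    exact hfin x₀
  · change tvDiff _ _ ((fun z => z - x₀) ⁻¹' _) ≤ _
    rwa [hset]

/-- The symmetrised increment of `V` at `p`: second order for `‖y‖ < r`, first order beyond. -/
def jump (r : ℝ) (V : Euc n → ℝ) (p y : Euc n) : ℝ :=
  if ‖y‖ < r then (2 * V p - V (p + y) - V (p - y)) / 2 else V p - V (p + y)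

/-- The unnormalised mollification of `u` at scale `r`. -/
def mollify (u φ : Euc n → ℝ) (r : ℝ) (p : Euc n) : ℝ := ∫ x, u x * φ (r⁻¹ • (p - x))

lemma IsBump.rescale {A r : ℝ} {φ : Euc n → ℝ} (hφ : IsBump A 1 0 φ) (hr : 0 < r) (p : Euc n) :
    IsBump A r p fun x => φ (r⁻¹ • (p - x)) := by
  refine ⟨hφ.contDiff.comp (by fun_prop), fun x => hφ.abs_le _, fun x z => ?_, fun x hx => ?_⟩
  · refine (hφ.lipschitz _ _).trans (le_of_eq ?_)
    rw [← smul_sub, sub_sub_sub_cancel_left, norm_smul, norm_sub_rev z, Real.norm_of_nonneg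
      (by positivity)]
    ring
  · refine hφ.eq_zero _ fun h => hx ?_
    rw [mem_ball_zero_iff, norm_smul, Real.norm_of_nonneg (by positivity),
      inv_mul_lt_iff₀ hr, mul_one] at h
    rwa [mem_ball, dist_eq_norm, norm_sub_rev]

lemma IsBump.hasCompactSupport {A r : ℝ} {p : Euc n} {ψ : Euc n → ℝ} (h : IsBump A r p ψ) :
    HasCompactSupport ψ :=
  HasCompactSupport.intro (isCompact_closedBall p r) fun x hx =>
    h.eq_zero x fun hx' => hx (ball_subset_closedBall hx')

lemma integral_weakIntegrand {A r : ℝ} {u φ : Euc n → ℝ} (hφ : IsBump A 1 0 φ)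
    (hu : Continuous u) (hr : 0 < r) (p y : Euc n) :
    ∫ x, weakIntegrand u (fun x => φ (r⁻¹ • (p - x))) r x y = jump r (mollify u φ r) p y := by
  have hb := fun p => hφ.rescale hr p
  have hc : Continuous φ := hφ.contDiff.continuous
  have hi : ∀ v : Euc n → ℝ, Continuous v → ∀ q, Integrable fun x => v x * φ (r⁻¹ • (q - x)) :=
    fun v hv q => Continuous.integrable_of_hasCompactSupport (by fun_prop)
      (hb q).hasCompactSupport.mul_left
  have hsh : ∀ q, (∫ x, u (x + y) * φ (r⁻¹ • (q - x))) = mollify u φ r (q + y) := fun q => by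
    rw [mollify, ← integral_add_right_eq_self (fun x => u x * φ (r⁻¹ • (q + y - x))) y]
    simp only [add_sub_add_right_eq_sub]
  have hu' : Continuous fun x => u (x + y) := by fun_prop
  have key : ∀ x, φ (r⁻¹ • (p - (x + y))) = φ (r⁻¹ • ((p - y) - x)) := fun x => by
    congr 2; abel
  have hd : ∀ q, Integrable fun x => u x * φ (r⁻¹ • (q - x)) - u (x + y) * φ (r⁻¹ • (q - x)) :=
    fun q => (hi u hu q).sub (hi _ hu' q)
  unfold weakIntegrand jump
  split_ifs with h
  · calc ∫ x, 1 / 2 * ((u x - u (x + y)) * (φ (r⁻¹ • (p - x)) - φ (r⁻¹ • (p - (x + y)))))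
        = ∫ x, 1 / 2 * ((u x * φ (r⁻¹ • (p - x)) - u (x + y) * φ (r⁻¹ • (p - x))) -
            (u x * φ (r⁻¹ • ((p - y) - x)) - u (x + y) * φ (r⁻¹ • ((p - y) - x)))) := by
          congr 1; ext x
          rw [key]; ring
      _ = _ := by
          rw [integral_const_mul, integral_sub (hd p) (hd (p - y)), integral_sub (hi u hu _)
            (hi _ hu' _),
            integral_sub (hi u hu _) (hi _ hu' _), hsh, hsh, sub_add_cancel]
          simp only [mollify]
          ring
  · simp_rw [sub_mul]
    rw [integral_sub (hi u hu _) (hi _ hu' _), hsh]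
    rfl

lemma integral_integral_weakIntegrand {s M β r A H : ℝ} {m : Measure (Euc n)}
    {u φ : Euc n → ℝ} (hs : 0 < s) (hM : 0 ≤ M) (hm : DyadicBound s M m)
    (hβ : 0 < β) (h1 : 2 * s < β + 1) (h2 : β < 2 * s) (hr : 0 < r) (hH : 0 ≤ H)
    (huc : Continuous u) (hu : ∀ x y, |u x - u y| ≤ H * ‖x - y‖ ^ β) (hφ : IsBump A 1 0 φ)
    (p : Euc n) :
    Integrable (fun x => ∫ y, weakIntegrand u (fun x => φ (r⁻¹ • (p - x))) r x y ∂m) ∧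
      ∫ x, ∫ y, weakIntegrand u (fun x => φ (r⁻¹ • (p - x))) r x y ∂m =
        ∫ y, jump r (mollify u φ r) p y ∂m := by
  have := hm.sigmaFinite hs hM
  have hb := hφ.rescale hr p
  have hA := hφ.nonneg
  have hw : Integrable (jumpWeight β r) m :=
    integrable_of_le_jumpWeight (c := 1) hM hm hβ h1 h2 hr
      measurable_jumpWeight.aestronglyMeasurable
      fun y => by rw [abs_of_nonneg (jumpWeight_nonneg hr y), one_mul]
  have h1 : Integrable ((ball p (2 * r)).indicator fun _ => A * H) (volume : Measure (Euc n)) :=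
    (integrable_indicator_iff measurableSet_ball).2
      (integrableOn_const measure_ball_lt_top.ne)
  have hmeas : Measurable fun q : Euc n × Euc n =>
      weakIntegrand u (fun x => φ (r⁻¹ • (p - x))) r q.1 q.2 := by
    have := (measurable_weakIntegrand_sub (r := r) huc hb.contDiff.continuous).comp
      (by fun_prop : Measurable fun q : Euc n × Euc n => (q.1, q.1 + q.2))
    simpa only [Function.comp_def, add_sub_cancel_left] using this
  have hInteg : Integrable (Function.uncurry
      (weakIntegrand u (fun x => φ (r⁻¹ • (p - x))) r)) (volume.prod m) := by
    refine (h1.mul_prod hw).mono' hmeas.aestronglyMeasurable (ae_of_all _ fun q => ?_)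
    change |weakIntegrand u _ r q.1 q.2| ≤ _
    by_cases hq : q.1 ∈ ball p (2 * r)
    · rw [indicator_of_mem hq]
      exact abs_weakIntegrand_le hH hβ hu hb _ _
    · rw [indicator_of_notMem hq, weakIntegrand_eq_zero hr hb hq]
      simp
  refine ⟨hInteg.integral_prod_left, ?_⟩
  rw [integral_integral_swap hInteg]
  simp_rw [integral_weakIntegrand hφ huc hr]

lemma abs_integral_integral_weakIntegrand_sub_le {s lam Lam β r A H η : ℝ}
    {K : Euc n → Measure (Euc n)} {u φ : Euc n → ℝ} (hs : 0 < s) (hLam : 0 ≤ Lam) (hη : 0 ≤ η)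
    (hKm : MeasKernel K) (hKs : DivSymmetric K) (hK : DivElliptic s lam Lam K)
    (hX : XReg s 0 η K)
    (hβ : 0 < β) (h1 : 2 * s < β + 1) (h2 : β < 2 * s) (hr : 0 < r) (hH : 0 ≤ H)
    (huc : Continuous u) (hu : ∀ x y, |u x - u y| ≤ H * ‖x - y‖ ^ β) (hφ : IsBump A 1 0 φ)
    (p x₀ : Euc n) :
    |1 / 2 * (∫ x, ∫ z, (u x - u z) * (φ (r⁻¹ • (p - x)) - φ (r⁻¹ • (p - z))) ∂(K x)) -
        ∫ y, jump r (mollify u φ r) p y ∂(centered K x₀)| ≤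
      A * H * (weightConst s β * (2 * 2 ^ (2 * s) * η) * r ^ (β - 2 * s)) *
        volume.real (ball p (2 * r)) := by
  have hb := hφ.rescale hr p
  have hA := hφ.nonneg
  obtain ⟨hi1, e1⟩ := half_integral_eq_weakIntegrand hs hLam hKm hKs hK hβ h1 h2 hr hH huc hu hb
  obtain ⟨hi2, e2⟩ := integral_integral_weakIntegrand hs hLam (centered_dyadicBound hK x₀) hβ h1 h2
    hr hH huc hu hφ p
  rw [e1, ← e2, ← integral_sub hi1 hi2, ← Real.norm_eq_abs,
    ← setIntegral_eq_integral_of_forall_compl_eq_zero (s := ball p (2 * r))]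
  · refine norm_setIntegral_le_of_norm_le_const measure_ball_lt_top fun x _ => ?_
    have hm : Measurable fun y => weakIntegrand u (fun x => φ (r⁻¹ • (p - x))) r x y := by
      have := (measurable_weakIntegrand_sub (r := r) huc hb.contDiff.continuous).comp
        (by fun_prop : Measurable fun y : Euc n => (x, x + y))
      simpa only [Function.comp_def, add_sub_cancel_left] using this
    exact abs_integral_sub_le_of_tvDiff hs hη hLam hβ h1 h2 hr
      (fun ρ hρ => tvDiff_centered_le hK hX x x₀ hρ) (centered_dyadicBound hK x)
      (centered_dyadicBound hK x₀) (mul_nonneg hA hH) hm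
      (fun y => abs_weakIntegrand_le hH hβ hu hb x y)
  · intro x hx
    simp [fun y => weakIntegrand_eq_zero (u := u) hr hb hx y]

lemma abs_integral_mul_bump_le {A r q N : ℝ} {p : Euc n} {f ψ : Euc n → ℝ} {Ω : Set (Euc n)}
    (hψ : IsBump A r p ψ) (hΩ : ball p r ⊆ Ω) (hq : 1 ≤ q) (hN : 0 ≤ N)
    (hf : eLpNorm f (ENNReal.ofReal q) (volume.restrict Ω) ≤ ENNReal.ofReal N) :
    |∫ x, f x * ψ x| ≤ A * N * volume.real (ball p r) ^ (1 - 1 / q) := by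
  have hA := hψ.nonneg
  by_cases hm : AEStronglyMeasurable (fun x => f x * ψ x) volume
  swap
  · rw [integral_non_aestronglyMeasurable hm, abs_zero]; positivity
  have hψc := hψ.contDiff.continuous
  set D := {x | ψ x ≠ 0} with hD
  have hDm : MeasurableSet D := (isOpen_ne_fun hψc continuous_const).measurableSet
  have hDb : D ⊆ ball p r := fun x hx => by
    by_contra h
    exact hx (hψ.eq_zero x h)
  have hfm : AEStronglyMeasurable f (volume.restrict D) := by
    have h1 : AEStronglyMeasurable (fun x => f x * ψ x * (ψ x)⁻¹) (volume.restrict D) :=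
      hm.restrict.mul (hψc.measurable.inv.aestronglyMeasurable)
    refine h1.congr ?_
    filter_upwards [ae_restrict_mem hDm] with x hx
    exact mul_inv_cancel_right₀ hx _
  have hq1 : (1 : ℝ≥0∞) ≤ ENNReal.ofReal q := by simpa using hq
  have h2 : ∫⁻ x in D, ‖f x‖ₑ ≤ ENNReal.ofReal (N * volume.real (ball p r) ^ (1 - 1 / q)) := by
    rw [← eLpNorm_one_eq_lintegral_enorm]
    refine (eLpNorm_le_eLpNorm_mul_rpow_measure_univ hq1 hfm).trans ?_
    rw [Measure.restrict_apply_univ, ENNReal.ofReal_mul hN, ENNReal.toReal_ofReal (by linarith),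
      ENNReal.toReal_one, div_one]
    have h3 : 0 ≤ 1 - 1 / q := by
      rw [sub_nonneg, div_le_one (by linarith)]; exact hq
    refine mul_le_mul' ((eLpNorm_mono_measure f (Measure.restrict_mono (hDb.trans hΩ) le_rfl)).trans
      hf) ?_
    rw [← ENNReal.ofReal_rpow_of_nonneg measureReal_nonneg h3, ofReal_measureReal
      measure_ball_lt_top.ne]
    gcongr
  have h3 : ‖∫ x, f x * ψ x‖ₑ ≤ ENNReal.ofReal (A * (N * volume.real (ball p r) ^ (1 - 1 / q))) :=
    calc ‖∫ x, f x * ψ x‖ₑ ≤ ∫⁻ x, ‖f x * ψ x‖ₑ := enorm_integral_le_lintegral_enorm _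
      _ = ∫⁻ x in D, ‖f x * ψ x‖ₑ := by
          rw [← lintegral_indicator hDm]
          congr 1; ext x
          by_cases hx : x ∈ D
          · rw [indicator_of_mem hx]
          · rw [indicator_of_notMem hx]
            have : ψ x = 0 := by simpa [hD] using hx
            simp [this]
      _ ≤ ∫⁻ x in D, ENNReal.ofReal A * ‖f x‖ₑ := by
          refine lintegral_mono fun x => ?_
          rw [enorm_mul, mul_comm]
          gcongr
          rw [Real.enorm_eq_ofReal_abs]
          exact ENNReal.ofReal_le_ofReal (hψ.abs_le x)
      _ ≤ _ := by
          rw [lintegral_const_mul' _ _ ENNReal.ofReal_ne_top, ENNReal.ofReal_mul hA]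
          gcongr
  rw [Real.enorm_eq_ofReal_abs, ENNReal.ofReal_le_ofReal_iff (by positivity)] at h3
  rwa [mul_assoc]

lemma volume_real_ball (p : Euc n) {r : ℝ} (hr : 0 < r) :
    volume.real (ball p r) = r ^ n * volume.real (ball (0 : Euc n) 1) := by
  rw [Measure.real, Measure.addHaar_ball_of_pos _ p hr, finrank_euclideanSpace_fin,
    ENNReal.toReal_mul, ENNReal.toReal_ofReal (by positivity), Measure.real]

/-- The constant in the approximate equation satisfied by mollified weak solutions. -/
def approxConst (n : ℕ) (s β A : ℝ) : ℝ :=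
  A * (weightConst s β * (2 * 2 ^ (2 * s)) * (2 ^ n * volume.real (ball (0 : Euc n) 1)) +
    volume.real (ball (0 : Euc n) 1) ^ (1 - 1 / ((n : ℝ) / (2 * s - β))))

/-- A mollified weak solution solves a frozen-coefficient equation up to a small error. -/
lemma abs_integral_jump_mollify_le {s lam Lam β r A H η N : ℝ} (hn : 1 ≤ n)
    {K : Euc n → Measure (Euc n)} {u f φ : Euc n → ℝ} (hs : 0 < s) (hs1 : s < 1) (hLam : 0 ≤ Lam)
    (hη : 0 ≤ η) (hKm : MeasKernel K) (hKs : DivSymmetric K) (hK : DivElliptic s lam Lam K)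
    (hX : XReg s 0 η K) (hβ : s < β) (hβ2 : β < 2 * s) (hr : 0 < r) (hH : 0 ≤ H) (hN : 0 ≤ N)
    (huc : Continuous u) (hu : ∀ x y, |u x - u y| ≤ H * ‖x - y‖ ^ β) (hφ : IsBump A 1 0 φ)
    (hsol : WeakSol K u f (ball 0 1))
    (hf : eLpNorm f (ENNReal.ofReal ((n : ℝ) / (2 * s - β))) (volume.restrict (ball 0 1)) ≤
      ENNReal.ofReal N)
    (p x₀ : Euc n) (hp : closedBall p r ⊆ ball 0 1) :
    |∫ y, jump r (mollify u φ r) p y ∂(centered K x₀)| ≤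
      approxConst n s β A * (η * H + N) * r ^ (n + β - 2 * s) := by
  have hn' : (1 : ℝ) ≤ n := by exact_mod_cast hn
  have hb := hφ.rescale hr p
  have hA := hφ.nonneg
  have hw := weightConst_pos (s := s) (β := β) (by linarith) hβ2
  have hq : 1 ≤ (n : ℝ) / (2 * s - β) := by
    rw [le_div_iff₀ (by linarith)]; linarith
  have h1 := abs_integral_integral_weakIntegrand_sub_le hs hLam hη hKm hKs hK hX (hs.trans hβ)
    (by linarith) hβ2 hr hH huc hu hφ p x₀
  have h2 := abs_integral_mul_bump_le hb (ball_subset_closedBall.trans hp) hq hN hf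
  have h3 := hsol.2.2 _ hb.contDiff hb.hasCompactSupport
    ((closure_minimal (fun x hx => ball_subset_closedBall
      (by by_contra h; exact hx (hb.eq_zero x h))) isClosed_closedBall).trans hp)
  rw [h3] at h1
  rw [volume_real_ball p (by linarith)] at h1
  rw [volume_real_ball p hr] at h2
  set ω := volume.real (ball (0 : Euc n) 1) with hω
  have hω0 : 0 ≤ ω := measureReal_nonneg
  have e1 : r ^ (β - 2 * s) * r ^ n = r ^ (n + β - 2 * s) := by
    rw [← Real.rpow_natCast, ← Real.rpow_add hr]; ring_nf
  have e2 : (r ^ n * ω) ^ (1 - 1 / ((n : ℝ) / (2 * s - β))) =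
      ω ^ (1 - 1 / ((n : ℝ) / (2 * s - β))) * r ^ (n + β - 2 * s) := by
    rw [Real.mul_rpow (by positivity) hω0, ← Real.rpow_natCast, ← Real.rpow_mul hr.le, mul_comm]
    congr 2
    field_simp
    ring
  rw [e2] at h2
  set ω' := ω ^ (1 - 1 / ((n : ℝ) / (2 * s - β)))
  have hω' : 0 ≤ ω' := by positivity
  set R := r ^ (n + β - 2 * s)
  have hR : 0 ≤ R := by positivity
  have h4 : A * H * (weightConst s β * (2 * 2 ^ (2 * s) * η) * r ^ (β - 2 * s)) *
      ((2 * r) ^ n * ω) =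
      A * (weightConst s β * (2 * 2 ^ (2 * s)) * (2 ^ n * ω)) * (η * H) * R := by
    rw [← e1, mul_pow]; ring
  rw [h4] at h1
  have h5 := abs_sub_abs_le_abs_sub (∫ y, jump r (mollify u φ r) p y ∂(centered K x₀))
    (∫ x, f x * φ (r⁻¹ • (p - x)))
  rw [abs_sub_comm] at h5
  have h6 : 0 ≤ A * ω' * (η * H) * R := by positivity
  have h7 : 0 ≤ A * (weightConst s β * (2 * 2 ^ (2 * s)) * (2 ^ n * ω)) * N * R := by positivity
  change _ ≤ A * (weightConst s β * (2 * 2 ^ (2 * s)) * (2 ^ n * ω) + ω') * (η * H + N) * R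
  calc _ ≤ A * (weightConst s β * (2 * 2 ^ (2 * s)) * (2 ^ n * ω)) * (η * H) * R +
        A * N * (ω' * R) := by linarith
    _ ≤ _ := by linarith

/-- A nonnegative normalised bump with quadratically bounded second differences. -/
structure IsKernelBump (A : ℝ) (φ : Euc n → ℝ) : Prop extends IsBump A 1 0 φ where
  nonneg' : ∀ x, 0 ≤ φ x
  integral_eq_one : ∫ x, φ x = 1
  second_le : ∀ x y, |2 * φ x - φ (x + y) - φ (x - y)| ≤ A * ‖y‖ ^ 2

lemma exists_second_difference_le {φ : Euc n → ℝ} (hφ : ContDiff ℝ (⊤ : ℕ∞) φ)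
    (hc : HasCompactSupport φ) :
    ∃ A, 0 ≤ A ∧ ∀ x y, |2 * φ x - φ (x + y) - φ (x - y)| ≤ A * ‖y‖ ^ 2 := by
  obtain ⟨L, hL⟩ := (hφ.fderiv_right (m := 1) (by norm_cast)).lipschitzWith_of_hasCompactSupport
    (hc.fderiv ℝ) (by simp)
  refine ⟨2 * L, by positivity, fun x y => ?_⟩
  have hd : Differentiable ℝ φ := hφ.differentiable (by simp)
  have hder : ∀ w ∈ closedBall (0 : Euc n) ‖y‖, HasFDerivWithinAt (fun w => φ (x + w) + φ (x - w))
      (fderiv ℝ φ (x + w) - fderiv ℝ φ (x - w)) (closedBall 0 ‖y‖) w := fun w _ => by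
    have h1 : HasFDerivAt (fun w => φ (x + w)) (fderiv ℝ φ (x + w)) w :=
      (hd (x + w)).hasFDerivAt.comp w ((hasFDerivAt_id w).const_add x)
    have h2 : HasFDerivAt (fun w => φ (x - w)) (-fderiv ℝ φ (x - w)) w := by
      have := (hd (x - w)).hasFDerivAt.comp w ((hasFDerivAt_id w).const_sub x)
      rwa [ContinuousLinearMap.comp_neg, ContinuousLinearMap.comp_id] at this
    rw [sub_eq_add_neg]
    exact (h1.add h2).hasFDerivWithinAt
  have hb : ∀ w ∈ closedBall (0 : Euc n) ‖y‖, ‖fderiv ℝ φ (x + w) - fderiv ℝ φ (x - w)‖ ≤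
      2 * L * ‖y‖ := fun w hw => by
    have h := hL.dist_le_mul (x + w) (x - w)
    rw [dist_eq_norm, dist_eq_norm, add_sub_sub_cancel, ← two_smul ℝ, norm_smul] at h
    rw [mem_closedBall_zero_iff] at hw
    calc _ ≤ L * (‖(2 : ℝ)‖ * ‖w‖) := h
      _ ≤ L * (2 * ‖y‖) := by
        gcongr
        simp
      _ = _ := by ring
  have h := (convex_closedBall (0 : Euc n) ‖y‖).norm_image_sub_le_of_norm_hasFDerivWithin_le hder hb
    (mem_closedBall_self (norm_nonneg _)) (by simp : y ∈ closedBall 0 ‖y‖)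
  rw [Real.norm_eq_abs, abs_sub_comm, add_zero, sub_zero, sub_zero] at h
  calc |2 * φ x - φ (x + y) - φ (x - y)| = |φ x + φ x - (φ (x + y) + φ (x - y))| := by
        congr 1; ring
    _ ≤ _ := h.trans (le_of_eq (by ring))

lemma exists_isKernelBump (n : ℕ) : ∃ A : ℝ, ∃ φ : Euc n → ℝ, IsKernelBump A φ := by
  let b : ContDiffBump (0 : Euc n) := ⟨1 / 2, 1, by norm_num, by norm_num⟩
  let φ : Euc n → ℝ := b.normed volume
  have hφ : ContDiff ℝ (⊤ : ℕ∞) φ := b.contDiff_normed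
  have hc : HasCompactSupport φ := b.hasCompactSupport_normed
  obtain ⟨A₁, hA₁, h₁⟩ := exists_second_difference_le hφ hc
  obtain ⟨L, hL⟩ := (hφ.of_le (m := 1) (by norm_cast)).lipschitzWith_of_hasCompactSupport hc
    (by simp)
  obtain ⟨A₂, hA₂⟩ := hc.exists_bound_of_continuous hφ.continuous
  refine ⟨A₁ + L + |A₂|, φ, ⟨hφ, fun x => ?_, fun x z => ?_, fun x hx => ?_⟩, fun x =>
    b.nonneg_normed x, b.integral_normed, fun x y => (h₁ x y).trans ?_⟩
  · have := hA₂ x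
    rw [Real.norm_eq_abs] at this
    have := le_abs_self A₂
    have : (0 : ℝ) ≤ L := L.2
    linarith
  · have := hL.dist_le_mul x z
    rw [dist_eq_norm, dist_eq_norm, Real.norm_eq_abs] at this
    refine this.trans ?_
    rw [inv_one, mul_one]
    gcongr
    have := abs_nonneg A₂
    linarith
  · rw [← Function.notMem_support]
    rwa [b.support_normed_eq]
  · gcongr
    have := abs_nonneg A₂
    have : (0 : ℝ) ≤ L := L.2
    linarith

lemma mollify_one_eq {v φ : Euc n → ℝ} (ξ : Euc n) :
    mollify v φ 1 ξ = ∫ w, v (ξ - w) * φ w := by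
  rw [mollify, ← integral_sub_left_eq_self _ _ ξ]
  simp

lemma IsKernelBump.mollify_sub_le {A β : ℝ} {v φ : Euc n → ℝ} (hφ : IsKernelBump A φ)
    (hvc : Continuous v) (hv : ∀ x y, |v x - v y| ≤ ‖x - y‖ ^ β) (ξ ζ : Euc n) :
    |mollify v φ 1 ξ - mollify v φ 1 ζ| ≤ ‖ξ - ζ‖ ^ β := by
  have hφc := hφ.contDiff.continuous
  have hi : ∀ q, Integrable fun w => v (q - w) * φ w := fun q =>
    Continuous.integrable_of_hasCompactSupport (by fun_prop) hφ.hasCompactSupport.mul_left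
  have hφi : Integrable φ := hφc.integrable_of_hasCompactSupport hφ.hasCompactSupport
  rw [mollify_one_eq, mollify_one_eq, ← integral_sub (hi ξ) (hi ζ)]
  calc |∫ w, v (ξ - w) * φ w - v (ζ - w) * φ w|
      ≤ ∫ w, |v (ξ - w) * φ w - v (ζ - w) * φ w| := abs_integral_le_integral_abs
    _ ≤ ∫ w, ‖ξ - ζ‖ ^ β * φ w := by
        refine integral_mono ((hi ξ).sub (hi ζ)).abs (hφi.const_mul _) fun w => ?_
        simp only
        rw [← sub_mul, abs_mul, abs_of_nonneg (hφ.nonneg' w)]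
        refine mul_le_mul_of_nonneg_right ((hv _ _).trans (le_of_eq ?_)) (hφ.nonneg' w)
        rw [sub_sub_sub_cancel_right]
    _ = _ := by rw [integral_const_mul, hφ.integral_eq_one, mul_one]

lemma IsKernelBump.abs_mollify_sub_self_le {A β : ℝ} {v φ : Euc n → ℝ} (hφ : IsKernelBump A φ)
    (hβ : 0 < β) (hvc : Continuous v) (hv : ∀ x y, |v x - v y| ≤ ‖x - y‖ ^ β) (ξ : Euc n) :
    |mollify v φ 1 ξ - v ξ| ≤ 1 := by
  have hφc := hφ.contDiff.continuous
  have hi : Integrable fun w => v (ξ - w) * φ w :=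
    Continuous.integrable_of_hasCompactSupport (by fun_prop) hφ.hasCompactSupport.mul_left
  have hφi : Integrable φ := hφc.integrable_of_hasCompactSupport hφ.hasCompactSupport
  have e : v ξ = ∫ w, v ξ * φ w := by rw [integral_const_mul, hφ.integral_eq_one, mul_one]
  rw [mollify_one_eq, e, ← integral_sub hi (hφi.const_mul _)]
  calc |∫ w, v (ξ - w) * φ w - v ξ * φ w|
      ≤ ∫ w, |v (ξ - w) * φ w - v ξ * φ w| := abs_integral_le_integral_abs
    _ ≤ ∫ w, φ w := by
        refine integral_mono (hi.sub (hφi.const_mul _)).abs hφi fun w => ?_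
        simp only
        rw [← sub_mul, abs_mul, abs_of_nonneg (hφ.nonneg' w)]
        by_cases hw : w ∈ ball (0 : Euc n) 1
        · refine mul_le_of_le_one_left (hφ.nonneg' w) ((hv _ _).trans ?_)
          rw [sub_sub_cancel_left, norm_neg]
          exact Real.rpow_le_one (norm_nonneg _) (mem_ball_zero_iff.1 hw).le hβ.le
        · rw [hφ.eq_zero w hw, mul_zero]
    _ = _ := hφ.integral_eq_one

lemma IsKernelBump.second_difference_mollify_le {A β : ℝ} {v φ : Euc n → ℝ}
    (hφ : IsKernelBump A φ) (hβ : 0 < β) (hvc : Continuous v)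
    (hv : ∀ x y, |v x - v y| ≤ ‖x - y‖ ^ β) (ξ : Euc n) {y : Euc n} (hy : ‖y‖ ≤ 1) :
    |2 * mollify v φ 1 ξ - mollify v φ 1 (ξ + y) - mollify v φ 1 (ξ - y)| ≤
      2 ^ β * A * volume.real (ball (0 : Euc n) 2) * ‖y‖ ^ 2 := by
  have hφc := hφ.contDiff.continuous
  have hcs := fun q => (hφ.toIsBump.rescale one_pos q).hasCompactSupport
  have hi : ∀ v : Euc n → ℝ, Continuous v → ∀ q,
      Integrable fun x => v x * φ ((1 : ℝ)⁻¹ • (q - x)) :=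
    fun v hv q => Continuous.integrable_of_hasCompactSupport (by fun_prop) (hcs q).mul_left
  set v' : Euc n → ℝ := fun x => v x - v ξ with hv'
  have hv'c : Continuous v' := by fun_prop
  have e : ∀ q, mollify v φ 1 q = mollify v' φ 1 q + v ξ := fun q => by
    have h1 : mollify v' φ 1 q = mollify v φ 1 q - mollify (fun _ => v ξ) φ 1 q := by
      simp only [mollify]
      rw [← integral_sub (hi v hvc q) (hi _ continuous_const q)]
      simp only [hv', sub_mul]
    have h2 : mollify (fun _ => v ξ) φ 1 q = v ξ := by
      rw [mollify_one_eq, integral_const_mul, hφ.integral_eq_one, mul_one]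
    rw [h1, h2]; ring
  have e2 : 2 * mollify v φ 1 ξ - mollify v φ 1 (ξ + y) - mollify v φ 1 (ξ - y) =
      ∫ x, v' x * (2 * φ (ξ - x) - φ (ξ - x + y) - φ (ξ - x - y)) := by
    have h1 : ∀ q, mollify v' φ 1 q = ∫ x, v' x * φ (q - x) := fun q => by simp [mollify]
    have h2 : ∀ q, Integrable fun x => v' x * φ (q - x) := fun q => by simpa using hi v' hv'c q
    have h3 : Integrable fun x => 2 * (v' x * φ (ξ - x)) - v' x * φ (ξ + y - x) :=
      ((h2 ξ).const_mul 2).sub (h2 _)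
    calc _ = 2 * mollify v' φ 1 ξ - mollify v' φ 1 (ξ + y) - mollify v' φ 1 (ξ - y) := by
          rw [e, e (ξ + y), e (ξ - y)]; ring
      _ = ∫ x, (2 * (v' x * φ (ξ - x)) - v' x * φ (ξ + y - x) - v' x * φ (ξ - y - x)) := by
          rw [integral_sub h3 (h2 _), integral_sub ((h2 ξ).const_mul 2) (h2 _),
            integral_const_mul, h1, h1, h1]
      _ = _ := by
          congr 1; ext x
          rw [show ξ - x + y = ξ + y - x by abel, show ξ - x - y = ξ - y - x by abel]
          ring
  rw [e2, ← setIntegral_eq_integral_of_forall_compl_eq_zero (s := ball ξ 2), ← Real.norm_eq_abs]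
  · have hvol : volume.real (ball ξ 2) = volume.real (ball (0 : Euc n) 2) := by
      rw [volume_real_ball ξ two_pos, volume_real_ball 0 two_pos]
    refine (norm_setIntegral_le_of_norm_le_const (C := 2 ^ β * (A * ‖y‖ ^ 2)) measure_ball_lt_top
      fun x hx => ?_).trans (le_of_eq (by rw [hvol]; ring))
    rw [norm_mul]
    refine mul_le_mul ((hv x ξ).trans ?_) (hφ.second_le _ _) (norm_nonneg _) (by positivity)
    rw [mem_ball, dist_eq_norm] at hx
    gcongr
  · intro x hx
    have hx' : 2 ≤ ‖ξ - x‖ := by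
      rw [mem_ball, dist_eq_norm, not_lt, norm_sub_rev] at hx; exact hx
    have hz : ∀ w : Euc n, ‖w‖ ≤ 1 → φ (ξ - x + w) = 0 := fun w hw => by
      refine hφ.eq_zero _ fun h => ?_
      rw [mem_ball_zero_iff] at h
      have : ‖ξ - x‖ ≤ ‖ξ - x + w‖ + ‖w‖ := by
        calc ‖ξ - x‖ = ‖(ξ - x + w) - w‖ := by rw [add_sub_cancel_right]
          _ ≤ _ := norm_sub_le _ _
      linarith
    have a := hz 0 (by simp)
    have b := hz y hy
    have c := hz (-y) (by simpa using hy)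
    rw [add_zero] at a
    rw [← sub_eq_add_neg] at c
    rw [a, b, c]; simp

/-- A translation-invariant jump measure of order `2s` with ellipticity constants `lam`, `Lam`. -/
def JumpElliptic (s lam Lam : ℝ) (m : Measure (Euc n)) : Prop :=
  DyadicBound s Lam m ∧ ∀ R : ℝ, 0 < R → ∀ e : Euc n, ‖e‖ = 1 →
    ENNReal.ofReal lam ≤
      ENNReal.ofReal (R ^ (2 * s - 2)) * ∫⁻ y in ball 0 R, ENNReal.ofReal (⟪e, y⟫ ^ 2) ∂m

/-- The jump measure of `K` at `x`, recentred and rescaled by `r`. -/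
def rescaled (s : ℝ) (K : Euc n → Measure (Euc n)) (x : Euc n) (r : ℝ) : Measure (Euc n) :=
  ENNReal.ofReal (r ^ (2 * s)) • Measure.map (fun y => r⁻¹ • y) (centered K x)

lemma centered_jumpElliptic {s lam Lam : ℝ} {K : Euc n → Measure (Euc n)}
    (hK : DivElliptic s lam Lam K) (x : Euc n) : JumpElliptic s lam Lam (centered K x) := by
  refine ⟨centered_dyadicBound hK x, fun R hR e he => (hK.2 x R hR e he).trans (le_of_eq ?_)⟩
  congr 1
  have hset : (fun z => z - x) ⁻¹' ball (0 : Euc n) R = ball x R := by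
    ext z; simp [dist_eq_norm]
  have h0 : ∀ z : Euc n, ENNReal.ofReal (⟪e, x - z⟫ ^ 2) = ENNReal.ofReal (⟪e, z - x⟫ ^ 2) :=
    fun z => by rw [← neg_sub z x, inner_neg_right, neg_sq]
  simp_rw [h0]
  calc ∫⁻ z in ball x R, ENNReal.ofReal (⟪e, z - x⟫ ^ 2) ∂(K x)
      = ∫⁻ y in ball 0 R, ENNReal.ofReal (⟪e, y⟫ ^ 2) ∂(Measure.map (fun z => z - x) (K x)) := by
        rw [← hset]
        exact (setLIntegral_map (f := fun y => ENNReal.ofReal (⟪e, y⟫ ^ 2)) (g := fun z => z - x)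
          measurableSet_ball (by fun_prop) (by fun_prop)).symm
    _ = ∫⁻ y in ball 0 R, ENNReal.ofReal (⟪e, y⟫ ^ 2) ∂(centered K x) := by
        rw [centered, Measure.restrict_restrict measurableSet_ball, ← Set.sdiff_eq]
        rw [← lintegral_inter_add_sdiff _ (ball (0 : Euc n) R) (measurableSet_singleton 0),
          setLIntegral_eq_zero (measurableSet_ball.inter (measurableSet_singleton _)), zero_add]
        intro y hy
        have : y = 0 := hy.2
        simp [this]

lemma rescaled_jumpElliptic {s lam Lam : ℝ} {K : Euc n → Measure (Euc n)}
    (hK : DivElliptic s lam Lam K) (x : Euc n) {r : ℝ} (hr : 0 < r) :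
    JumpElliptic s lam Lam (rescaled s K x r) := by
  have hc := centered_jumpElliptic hK x
  have hmeas : Measurable fun y : Euc n => r⁻¹ • y := by fun_prop
  have hpos : 0 < r ^ (2 * s) := by positivity
  have hball : ∀ ρ : ℝ, (fun y : Euc n => r⁻¹ • y) ⁻¹' ball 0 ρ = ball 0 (r * ρ) := fun ρ => by
    ext y
    simp only [mem_preimage, mem_ball_zero_iff, norm_smul, norm_inv, Real.norm_of_nonneg hr.le]
    rw [inv_mul_lt_iff₀ hr]
  refine ⟨⟨?_, fun ρ hρ => ?_⟩, fun R hR e he => ?_⟩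
  · have : (fun y : Euc n => r⁻¹ • y) ⁻¹' {0} = {0} := by
      ext y; simp [hr.ne']
    rw [rescaled, Measure.smul_apply, Measure.map_apply hmeas (measurableSet_singleton _), this,
      hc.1.1, smul_zero]
  · rw [rescaled, Measure.smul_apply,
      Measure.map_apply hmeas (measurableSet_ball.diff measurableSet_ball), preimage_sdiff, hball,
      hball, smul_eq_mul, mul_left_comm]
    refine (mul_le_mul_right (hc.1.2 (r * ρ) (by positivity)) _).trans (le_of_eq ?_)
    rw [← ENNReal.ofReal_mul hpos.le, Real.mul_rpow hr.le hρ.le, Real.rpow_neg hr.le]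
    congr 1
    field_simp
  · refine (hc.2 (r * R) (by positivity) e he).trans (le_of_eq ?_)
    rw [rescaled, Measure.restrict_smul, lintegral_smul_measure,
      setLIntegral_map measurableSet_ball (by fun_prop) hmeas, hball, smul_eq_mul, ← mul_assoc,
      ← ENNReal.ofReal_mul (by positivity)]
    have h1 : ∀ y : Euc n, ENNReal.ofReal (⟪e, r⁻¹ • y⟫ ^ 2) =
        ENNReal.ofReal (r⁻¹ ^ 2) * ENNReal.ofReal (⟪e, y⟫ ^ 2) := fun y => by
      rw [inner_smul_right, mul_pow, ENNReal.ofReal_mul (by positivity)]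
    simp_rw [h1]
    rw [lintegral_const_mul' _ _ ENNReal.ofReal_ne_top, ← mul_assoc,
      ← ENNReal.ofReal_mul (by positivity)]
    congr 2
    rw [Real.mul_rpow hr.le hR.le, Real.rpow_sub hr, Real.rpow_two]
    field_simp

/-- The blow-up of `u` at `x` and scale `r`, for functions of `β`-Hölder size `H`. -/
def blowup (u : Euc n → ℝ) (x : Euc n) (r h : ℝ) (w : Euc n) : ℝ := h⁻¹ * u (x + r • w)

lemma mollify_blowup {u φ : Euc n → ℝ} {r h : ℝ} (hr : 0 < r) (x ξ : Euc n) :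
    mollify u φ r (x + r • ξ) * h⁻¹ = r ^ n * mollify (blowup u x r h) φ 1 ξ := by
  have h1 := Measure.integral_comp_smul (volume : Measure (Euc n))
    (fun z => u (x + z) * φ (r⁻¹ • (r • ξ - z))) r
  rw [finrank_euclideanSpace_fin, abs_of_pos (by positivity), smul_eq_mul] at h1
  have h2 : mollify u φ r (x + r • ξ) = ∫ z, u (x + z) * φ (r⁻¹ • (r • ξ - z)) := by
    rw [mollify, ← integral_add_left_eq_self _ x]
    simp only [add_sub_add_left_eq_sub]
  have h3 : mollify (blowup u x r h) φ 1 ξ =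
      h⁻¹ * ∫ w, u (x + r • w) * φ (r⁻¹ • (r • ξ - r • w)) := by
    rw [mollify, ← integral_const_mul]
    congr 1; ext w
    rw [blowup, ← smul_sub, inv_smul_smul₀ hr.ne', inv_one, one_smul]
    ring
  rw [h3, h1, h2]
  field_simp

lemma integral_jump_rescaled {s r h : ℝ} {K : Euc n → Measure (Euc n)} {u φ : Euc n → ℝ}
    (hr : 0 < r) (x ξ : Euc n) :
    ∫ y, jump 1 (mollify (blowup u x r h) φ 1) ξ y ∂(rescaled s K x r) =
      r ^ (2 * s) * h⁻¹ * (r ^ n)⁻¹ *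
        ∫ y, jump r (mollify u φ r) (x + r • ξ) y ∂(centered K x) := by
  let T : Euc n ≃ᵐ Euc n := MeasurableEquiv.smul₀ r⁻¹ (by positivity)
  rw [rescaled, integral_smul_measure, ENNReal.toReal_ofReal (by positivity), smul_eq_mul,
    mul_assoc, mul_assoc, ← mul_assoc h⁻¹]
  congr 1
  rw [← integral_const_mul]
  refine (integral_map_equiv T _).trans (integral_congr_ae (ae_of_all _ fun y => ?_))
  change jump 1 _ ξ (r⁻¹ • y) = _
  have hm : ∀ q, mollify (blowup u x r h) φ 1 q = h⁻¹ * (r ^ n)⁻¹ * mollify u φ r (x + r • q) :=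
    fun q => by
      have := mollify_blowup (u := u) (φ := φ) (h := h) hr x q
      rw [mul_assoc, mul_left_comm, mul_comm h⁻¹, this]
      field_simp
  have hc : ‖r⁻¹ • y‖ < 1 ↔ ‖y‖ < r := by
    rw [norm_smul, norm_inv, Real.norm_of_nonneg hr.le, inv_mul_lt_iff₀ hr, mul_one]
  simp only [jump, hm, hc, smul_add, smul_sub, smul_inv_smul₀ hr.ne', ← add_assoc, ← add_sub_assoc]
  split_ifs <;> ring

/-- A function with normalised `β`-Hölder bound and second differences of size `C`. -/
structure IsProfile (β C : ℝ) (V : Euc n → ℝ) : Prop where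
  holder : ∀ x y, |V x - V y| ≤ ‖x - y‖ ^ β
  second_le : ∀ x y, ‖y‖ ≤ 1 → |2 * V x - V (x + y) - V (x - y)| ≤ C * ‖y‖ ^ 2

lemma continuous_of_le_rpow {β : ℝ} (hβ : 0 < β) {V : Euc n → ℝ}
    (h : ∀ x y, |V x - V y| ≤ ‖x - y‖ ^ β) : Continuous V := by
  refine continuous_iff_continuousAt.2 fun x => tendsto_iff_norm_sub_tendsto_zero.2 ?_
  have h0 : Filter.Tendsto (fun y : Euc n => ‖y - x‖ ^ β) (𝓝 x) (𝓝 0) := by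
    have : Continuous fun y : Euc n => ‖y - x‖ ^ β := by fun_prop (disch := linarith)
    simpa [Real.zero_rpow hβ.ne'] using this.tendsto x
  exact squeeze_zero (fun _ => norm_nonneg _) (fun y => h y x) h0

lemma IsProfile.neg {β C : ℝ} {V : Euc n → ℝ} (h : IsProfile β C V) :
    IsProfile β C fun x => -V x := by
  refine ⟨fun x y => ?_, fun x y hy => ?_⟩
  · rw [neg_sub_neg, abs_sub_comm]; exact h.holder x y
  · have := h.second_le x y hy
    rw [← abs_neg]
    convert this using 2
    ring

lemma jump_neg (r : ℝ) (V : Euc n → ℝ) (p y : Euc n) :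
    jump r (fun x => -V x) p y = -jump r V p y := by
  unfold jump; split_ifs <;> ring

lemma measurable_jump {r : ℝ} {V : Euc n → ℝ} (hV : Continuous V) (p : Euc n) :
    Measurable (jump r V p) := by
  unfold jump
  exact Measurable.ite (measurableSet_lt measurable_norm measurable_const)
    (by fun_prop) (by fun_prop)

lemma IsProfile.integrable_jump {s M β C : ℝ} {m : Measure (Euc n)} {V : Euc n → ℝ}
    (hM : 0 ≤ M) (hm : DyadicBound s M m) (hβ : 0 < β) (hβ1 : β < 1) (h1 : 2 * s < β + 1)
    (h2 : β < 2 * s) (hV : IsProfile β C V) (p : Euc n) : Integrable (jump 1 V p) m := by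
  refine integrable_of_le_jumpWeight (c := |C| + 1) hM hm hβ h1 h2 one_pos
    (measurable_jump (continuous_of_le_rpow hβ hV.holder) p).aestronglyMeasurable fun y => ?_
  have hC := abs_nonneg C
  unfold jump jumpWeight
  split_ifs with hy
  · have h3 := hV.second_le p y hy.le
    have h4 : ‖y‖ ^ 2 ≤ ‖y‖ ^ (β + 1) := by
      rw [← Real.rpow_two]
      exact Real.rpow_le_rpow_of_exponent_ge_of_imp (norm_nonneg _) hy.le (by linarith)
        fun _ _ => by exfalso; linarith
    rw [abs_div, abs_two, inv_one, one_mul]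
    have h5 : C * ‖y‖ ^ 2 ≤ |C| * ‖y‖ ^ (β + 1) := by
      have := le_abs_self C
      gcongr
    have : 0 ≤ |C| * ‖y‖ ^ (β + 1) := by positivity
    have : 0 ≤ ‖y‖ ^ (β + 1) := by positivity
    linarith
  · have h3 := hV.holder p (p + y)
    rw [sub_add_cancel_left, norm_neg] at h3
    have : 0 ≤ |C| * ‖y‖ ^ β := by positivity
    linarith

/-- The points that keep a positive amount of mass nearby along the ultrafilter `F`. -/
def charged (F : Ultrafilter ℕ) (μ : ℕ → Measure (Euc n)) : Set (Euc n) :=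
  {y | ∀ τ : ℝ, 0 < τ → ∃ c : ℝ, 0 < c ∧ ∀ᶠ k in F, ENNReal.ofReal c ≤ μ k (ball y τ)}

lemma eventually_measure_lt_of_disjoint_charged {F : Ultrafilter ℕ} {μ : ℕ → Measure (Euc n)}
    {Q : Set (Euc n)} (hQ : IsCompact Q) (h : Disjoint Q (charged F μ)) {c : ℝ} (hc : 0 < c) :
    ∀ᶠ k in F, μ k Q < ENNReal.ofReal c := by
  refine hQ.induction_on (p := fun A => ∀ c : ℝ, 0 < c → ∀ᶠ k in F, μ k A < ENNReal.ofReal c)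
    ?_ ?_ ?_ ?_ c hc
  · intro c hc
    simp [hc]
  · intro A B hAB hB c hc
    filter_upwards [hB c hc] with k hk using (measure_mono hAB).trans_lt hk
  · intro A B hA hB c hc
    filter_upwards [hA (c / 2) (by linarith), hB (c / 2) (by linarith)] with k h1 h2
    refine (measure_union_le _ _).trans_lt ((ENNReal.add_lt_add h1 h2).trans_le ?_)
    rw [← ENNReal.ofReal_add (by linarith) (by linarith), add_halves]
  · intro y hy
    have hy' : y ∉ charged F μ := disjoint_left.1 h hy
    simp only [charged, mem_ofPred_eq, not_forall, not_exists, not_and] at hy'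
    obtain ⟨τ, hτ, hy'⟩ := hy'
    refine ⟨ball y τ, mem_nhdsWithin_of_mem_nhds (ball_mem_nhds y hτ), fun c hc => ?_⟩
    have := Ultrafilter.eventually_not.2 (hy' c hc)
    filter_upwards [this] with k hk using not_le.1 hk

lemma exists_charged_inner_ne_zero {s lam Lam : ℝ} (hs : 0 < s) (hs1 : s < 1) (hlam : 0 < lam)
    (hLam : 0 ≤ Lam) {F : Ultrafilter ℕ} {μ : ℕ → Measure (Euc n)}
    (hμ : ∀ k, JumpElliptic s lam Lam (μ k)) {r : ℝ} (hr : 0 < r) {e : Euc n} (he : ‖e‖ = 1) :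
    ∃ y ∈ charged F μ, ‖y‖ ≤ r ∧ ⟪e, y⟫ ≠ 0 := by
  by_contra! hcon
  have g1 := geomConst_pos (t := 2 - 2 * s) (by linarith)
  have g2 := geomConst_pos (t := 2 * s) (by linarith)
  set a := geomConst (2 - 2 * s) * (2 ^ (2 * s) * Lam) + geomConst (2 * s) * Lam with ha
  have ha0 : 0 ≤ a := by positivity
  have hlim : Filter.Tendsto (fun t : ℝ => r ^ (2 * s - 2) * (a * t ^ (2 - 2 * s))) (𝓝[>] 0)
      (𝓝 0) := by
    have : ContinuousAt (fun t : ℝ => r ^ (2 * s - 2) * (a * t ^ (2 - 2 * s))) 0 := by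
      fun_prop (disch := first | positivity | (right; linarith))
    have := this.tendsto
    rw [Real.zero_rpow (by linarith), mul_zero, mul_zero] at this
    exact this.mono_left nhdsWithin_le_nhds
  obtain ⟨t, htl, ht⟩ := ((hlim.eventually (gt_mem_nhds (half_pos hlam))).and
    self_mem_nhdsWithin).exists
  have ht : 0 < t := ht
  set Q : Set (Euc n) := closedBall 0 r ∩ {y | t ≤ |⟪e, y⟫|} with hQ
  have hQc : IsCompact Q := (isCompact_closedBall _ _).inter_right
    (isClosed_le continuous_const (by fun_prop))
  have hd : Disjoint Q (charged F μ) := by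
    refine disjoint_left.2 fun y hy hy' => ?_
    have h0 := hcon y hy' (by simpa using hy.1)
    have := hy.2
    simp only [mem_ofPred_eq, h0, abs_zero] at this
    linarith
  set c := lam / 2 / (r ^ (2 * s - 2) * r ^ 2) with hc
  have hc0 : 0 < c := by positivity
  obtain ⟨k, hk⟩ := (eventually_measure_lt_of_disjoint_charged hQc hd hc0).exists
  have hm := (hμ k).1
  have hInteg : ∫⁻ y in ball 0 r, ENNReal.ofReal (⟪e, y⟫ ^ 2) ∂(μ k) ≤
      ENNReal.ofReal (a * t ^ (2 - 2 * s)) + ENNReal.ofReal (r ^ 2 * c) := by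
    calc ∫⁻ y in ball 0 r, ENNReal.ofReal (⟪e, y⟫ ^ 2) ∂(μ k)
        ≤ ∫⁻ y in (ball 0 t ∪ (ball 0 t)ᶜ \ Q) ∩ ball 0 r ∪ Q,
            ENNReal.ofReal (⟪e, y⟫ ^ 2) ∂(μ k) := by
          refine lintegral_mono_set fun y hy => ?_
          by_cases h1 : y ∈ Q
          · exact Or.inr h1
          · by_cases h2 : y ∈ ball (0 : Euc n) t
            · exact Or.inl ⟨Or.inl h2, hy⟩
            · exact Or.inl ⟨Or.inr ⟨h2, h1⟩, hy⟩
      _ ≤ (∫⁻ y in ball 0 t, ENNReal.ofReal (‖y‖ ^ (2 : ℝ)) ∂(μ k)) +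
            ENNReal.ofReal (t ^ 2) * μ k (ball 0 t)ᶜ + ENNReal.ofReal (r ^ 2) * μ k Q := by
          refine (lintegral_union_le _ _ _).trans (add_le_add ?_ ?_)
          · rw [union_inter_distrib_right]
            refine (lintegral_union_le _ _ _).trans (add_le_add ?_ ?_)
            · refine (lintegral_mono_set inter_subset_left).trans (lintegral_mono fun y => ?_)
              refine ENNReal.ofReal_le_ofReal ?_
              rw [Real.rpow_two]
              refine sq_le_sq' ?_ ?_ <;>
              · have := abs_le.1 (abs_real_inner_le_norm e y)
                rw [he, one_mul] at this
                linarith [this.1, this.2]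
            · refine (setLIntegral_mono' (g := fun _ => ENNReal.ofReal (t ^ 2))
                ((measurableSet_ball.compl.diff hQc.measurableSet).inter measurableSet_ball)
                fun y hy => ENNReal.ofReal_le_ofReal ?_).trans ?_
              · have h1 : ¬ t ≤ |⟪e, y⟫| := fun h =>
                  hy.1.2 ⟨ball_subset_closedBall hy.2, h⟩
                exact (sq_le_sq₀ (abs_nonneg _) ht.le).2 (not_le.1 h1).le |>.trans' (by rw [sq_abs])
              · rw [setLIntegral_const]
                gcongr
                exact inter_subset_left.trans sdiff_subset
          · refine (setLIntegral_mono' (g := fun _ => ENNReal.ofReal (r ^ 2)) hQc.measurableSet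
              fun y hy => ENNReal.ofReal_le_ofReal ?_).trans (by rw [setLIntegral_const])
            have h1 := abs_real_inner_le_norm e y
            have h2 : ‖y‖ ≤ r := by simpa using hy.1
            rw [he, one_mul] at h1
            rw [← sq_abs]
            gcongr
            exact h1.trans h2
      _ ≤ _ := by
          refine add_le_add ?_ ?_
          · have e1 := setLIntegral_ball_rpow_le hLam hm (p := 2) (by norm_num) (by linarith) ht
            have e2 := hm.measure_compl_ball_le hs hLam ht
            refine (add_le_add e1 (mul_le_mul_right e2 _)).trans (le_of_eq ?_)
            rw [← ENNReal.ofReal_mul (by positivity), ← ENNReal.ofReal_add (by positivity)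
              (by positivity), ha]
            congr 1
            have : t ^ (2 - 2 * s) = t ^ 2 * t ^ (-(2 * s)) := by
              rw [← Real.rpow_two, ← Real.rpow_add ht]; ring_nf
            rw [this]; ring
          · refine (mul_le_mul_right hk.le _).trans (le_of_eq ?_)
            rw [← ENNReal.ofReal_mul (by positivity)]
  have h1 := ((hμ k).2 r hr e he).trans (mul_le_mul_right hInteg _)
  rw [← ENNReal.ofReal_add (by positivity) (by positivity), ← ENNReal.ofReal_mul (by positivity),
    ENNReal.ofReal_le_ofReal_iff (by positivity), mul_add] at h1
  have h2 : r ^ (2 * s - 2) * (r ^ 2 * c) = lam / 2 := by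
    rw [hc]; field_simp
  linarith

lemma le_integral_of_annulus_bounds {s M : ℝ} {m : Measure (Euc n)} (hs : 0 < s) (hs1 : s < 1)
    (hM : 0 ≤ M) (hm : DyadicBound s M m) {J : Euc n → ℝ} (hJ : Integrable J m)
    {a b c d τ R : ℝ} (ha : 0 ≤ a) (hb : 0 ≤ b) (hc : 0 ≤ c) (hτ : 0 < τ) (hR : 0 < R)
    {E : Set (Euc n)} (hE : MeasurableSet E) (hEτ : E ⊆ (ball 0 τ)ᶜ)
    (h1 : ∀ y, ‖y‖ < τ → -(a * ‖y‖ ^ 2) ≤ J y) (h2 : ∀ y ∈ E, d - b ≤ J y)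
    (h3 : ∀ y, τ ≤ ‖y‖ → ‖y‖ < R → -b ≤ J y) (h4 : ∀ y, R ≤ ‖y‖ → -b - c ≤ J y) :
    d * m.real E - a * (geomConst (2 - 2 * s) * (2 ^ (2 * s) * M * τ ^ (2 - 2 * s))) -
        b * (geomConst (2 * s) * (M * τ ^ (-(2 * s)))) -
        c * (geomConst (2 * s) * (M * R ^ (-(2 * s)))) ≤ ∫ y, J y ∂m := by
  have g1 := geomConst_pos (t := 2 - 2 * s) (by linarith)
  have g2 := geomConst_pos (t := 2 * s) (by linarith)
  have hBτ := hm.measure_compl_ball_le hs hM hτ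
  have hBR := hm.measure_compl_ball_le hs hM hR
  have hsq := setLIntegral_ball_rpow_le hM hm (p := 2) (by norm_num) (by linarith) hτ
  simp only [Real.rpow_two] at hsq
  have hi1 : IntegrableOn (fun y : Euc n => ‖y‖ ^ 2) (ball 0 τ) m := by
    refine ⟨by fun_prop, ?_⟩
    rw [hasFiniteIntegral_iff_ofReal (ae_of_all _ fun y => by positivity)]
    exact hsq.trans_lt ENNReal.ofReal_lt_top
  have hv1 : ∫ y in ball 0 τ, ‖y‖ ^ 2 ∂m ≤
      geomConst (2 - 2 * s) * (2 ^ (2 * s) * M * τ ^ (2 - 2 * s)) := by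
    rw [← ENNReal.ofReal_le_ofReal_iff (by positivity),
      ofReal_integral_eq_lintegral_ofReal hi1 (ae_of_all _ fun y => by positivity)]
    exact hsq
  have hv2 : m.real (ball 0 τ)ᶜ ≤ geomConst (2 * s) * (M * τ ^ (-(2 * s))) :=
    ENNReal.toReal_le_of_le_ofReal (by positivity) hBτ
  have hv3 : m.real (ball 0 R)ᶜ ≤ geomConst (2 * s) * (M * R ^ (-(2 * s))) :=
    ENNReal.toReal_le_of_le_ofReal (by positivity) hBR
  have hfτ : m (ball 0 τ)ᶜ ≠ ⊤ := (hBτ.trans_lt ENNReal.ofReal_lt_top).ne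
  have hfR : m (ball 0 R)ᶜ ≠ ⊤ := (hBR.trans_lt ENNReal.ofReal_lt_top).ne
  have hfE : m E ≠ ⊤ := ((measure_mono hEτ).trans_lt hfτ.lt_top).ne
  have hI1 : Integrable ((ball 0 τ).indicator fun y : Euc n => a * ‖y‖ ^ 2) m :=
    (integrable_indicator_iff measurableSet_ball).2 (hi1.const_mul a)
  have hI2 : Integrable ((ball (0 : Euc n) τ)ᶜ.indicator fun _ => b) m :=
    (integrable_indicator_iff measurableSet_ball.compl).2 (integrableOn_const hfτ)
  have hI3 : Integrable ((ball (0 : Euc n) R)ᶜ.indicator fun _ => c) m :=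
    (integrable_indicator_iff measurableSet_ball.compl).2 (integrableOn_const hfR)
  have hI4 : Integrable (E.indicator fun _ => d) m :=
    (integrable_indicator_iff hE).2 (integrableOn_const hfE)
  have hmono := integral_mono (((hI4.sub hI1).sub hI2).sub hI3) hJ fun y => by
    classical
    simp only [Pi.sub_apply, indicator_apply, mem_compl_iff, mem_ball_zero_iff, not_lt]
    have hay : 0 ≤ a * ‖y‖ ^ 2 := by positivity
    by_cases hyE : y ∈ E
    · have := h2 y hyE
      have hτy : τ ≤ ‖y‖ := by simpa using hEτ hyE
      rw [if_pos hyE, if_neg (not_lt.2 hτy), if_pos hτy]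
      split_ifs <;> linarith
    · rw [if_neg hyE]
      rcases lt_or_ge ‖y‖ τ with hy | hy
      · have := h1 y hy
        rw [if_pos hy, if_neg (not_le.2 hy)]
        split_ifs <;> linarith
      · rw [if_neg (not_lt.2 hy), if_pos hy]
        split_ifs with hyR
        · linarith [h4 y hyR]
        · linarith [h3 y hy (not_le.1 hyR)]
  refine le_trans ?_ hmono
  rw [integral_sub' ((hI4.sub hI1).sub hI2) hI3, integral_sub' (hI4.sub hI1) hI2,
    integral_sub' hI4 hI1, integral_indicator measurableSet_ball,
    integral_indicator_const _ hE, integral_indicator_const _ measurableSet_ball.compl,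
    integral_indicator_const _ measurableSet_ball.compl, integral_const_mul]
  simp only [smul_eq_mul]
  rw [mul_comm d, mul_comm _ b, mul_comm _ c]
  gcongr

/-- Profiles `V k` that converge to `W` while their jump integrals vanish in the limit. -/
structure IsBlowupLimit (s β lam Lam C : ℝ) (F : Ultrafilter ℕ) (μ : ℕ → Measure (Euc n))
    (V : ℕ → Euc n → ℝ) (W : Euc n → ℝ) : Prop where
  elliptic : ∀ k, JumpElliptic s lam Lam (μ k)
  profile : ∀ k, IsProfile β C (V k)
  tendsto : ∀ x, Filter.Tendsto (fun k => V k x) F (𝓝 (W x))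
  equation : ∀ ξ, Filter.Tendsto (fun k => ∫ y, jump 1 (V k) ξ y ∂(μ k)) F (𝓝 0)

namespace IsBlowupLimit

variable {s β lam Lam C : ℝ} {F : Ultrafilter ℕ} {μ : ℕ → Measure (Euc n)}
  {V : ℕ → Euc n → ℝ} {W : Euc n → ℝ}

lemma neg (h : IsBlowupLimit s β lam Lam C F μ V W) :
    IsBlowupLimit s β lam Lam C F μ (fun k x => -V k x) fun x => -W x := by
  refine ⟨h.elliptic, fun k => (h.profile k).neg, fun x => (h.tendsto x).neg, fun ξ => ?_⟩
  simpa only [jump_neg, integral_neg, neg_zero] using (h.equation ξ).neg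

lemma holder (h : IsBlowupLimit s β lam Lam C F μ V W) (x y : Euc n) :
    |W x - W y| ≤ ‖x - y‖ ^ β :=
  le_of_tendsto ((h.tendsto x).sub (h.tendsto y)).abs
    (Filter.Eventually.of_forall fun k => (h.profile k).holder x y)

lemma eventually_abs_sub_le (h : IsBlowupLimit s β lam Lam C F μ V W) (hβ : 0 < β)
    {Q : Set (Euc n)} (hQ : IsCompact Q) {ε : ℝ} (hε : 0 < ε) :
    ∀ᶠ k in F, ∀ y ∈ Q, |V k y - W y| ≤ ε := by
  refine hQ.induction_on (p := fun A => ∀ᶠ k in F, ∀ y ∈ A, |V k y - W y| ≤ ε) ?_ ?_ ?_ ?_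
  · simp
  · intro A B hAB hB
    filter_upwards [hB] with k hk y hy using hk y (hAB hy)
  · intro A B hA hB
    filter_upwards [hA, hB] with k h1 h2 y hy using hy.elim (h1 y) (h2 y)
  · intro x _
    set τ := (ε / 3) ^ β⁻¹ with hτ
    have hτ0 : 0 < τ := by positivity
    have hτβ : τ ^ β = ε / 3 := Real.rpow_inv_rpow (by positivity) hβ.ne'
    refine ⟨ball x τ, mem_nhdsWithin_of_mem_nhds (ball_mem_nhds x hτ0), ?_⟩
    have := (h.tendsto x).eventually (Metric.ball_mem_nhds _ (show 0 < ε / 3 by positivity))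
    filter_upwards [this] with k hk y hy
    have hk' : |V k x - W x| < ε / 3 := hk
    have hy' : ‖y - x‖ ^ β ≤ ε / 3 := by
      rw [← hτβ]
      exact Real.rpow_le_rpow (norm_nonneg _) (mem_ball_iff_norm.1 hy).le hβ.le
    have e1 := abs_le.1 (((h.profile k).holder y x).trans hy')
    have e2 := abs_le.1 ((h.holder y x).trans hy')
    have e3 := abs_lt.1 hk'
    exact abs_le.2 ⟨by linarith [e1.1, e2.2, e3.1], by linarith [e1.2, e2.1, e3.2]⟩

end IsBlowupLimit

namespace IsBlowupLimit

variable {s β lam Lam C : ℝ} {F : Ultrafilter ℕ} {μ : ℕ → Measure (Euc n)}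
  {V : ℕ → Euc n → ℝ} {W : Euc n → ℝ}

/-- The almost maximal values of an increment of the limit propagate along charged vectors. -/
lemma exists_increment_ge (h : IsBlowupLimit s β lam Lam C F μ V W) (hs : 0 < s) (hs1 : s < 1)
    (hLam : 0 ≤ Lam) (hC : 0 ≤ C) (hβ : 0 < β) (hβ1 : β < 1) (h1 : 2 * s < β + 1)
    (h2 : β < 2 * s) {e : Euc n} (he : e ∈ charged F μ) (he0 : e ≠ 0) (he2 : ‖e‖ < 1 / 2)
    {M : ℝ} (hM : ∀ x, W (x + e) - W x ≤ M) {ε' : ℝ} (hε' : 0 < ε') :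
    ∃ ε, 0 < ε ∧ ∀ x, M - ε ≤ W (x + e) - W x → M - ε' ≤ W (x + e + e) - W (x + e) := by
  have he0 : 0 < ‖e‖ := norm_pos_iff.2 he0
  have g1 := geomConst_pos (t := 2 - 2 * s) (by linarith)
  have g2 := geomConst_pos (t := 2 * s) (by linarith)
  obtain ⟨τ', hτ'0, hτ'e, hτ'⟩ : ∃ t : ℝ, 0 < t ∧ t ≤ ‖e‖ / 2 ∧ t ^ β ≤ ε' / 8 := by
    refine ⟨min (‖e‖ / 2) ((ε' / 8) ^ β⁻¹), by positivity, min_le_left _ _, ?_⟩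
    refine (Real.rpow_le_rpow (by positivity) (min_le_right _ _) hβ.le).trans (le_of_eq ?_)
    exact Real.rpow_inv_rpow (by positivity) hβ.ne'
  obtain ⟨c₀, hc₀, hmass⟩ := he τ' hτ'0
  set κ := 3 * ε' / 8 * c₀ with hκ
  have hκ0 : 0 < κ := by positivity
  obtain ⟨τ, hτ0, hτe, hτ⟩ : ∃ t : ℝ, 0 < t ∧ t ≤ ‖e‖ / 2 ∧
      C * (geomConst (2 - 2 * s) * (2 ^ (2 * s) * Lam * t ^ (2 - 2 * s))) ≤ κ / 4 := by
    have hcont : ContinuousAt (fun t : ℝ =>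
        C * (geomConst (2 - 2 * s) * (2 ^ (2 * s) * Lam * t ^ (2 - 2 * s)))) 0 := by
      fun_prop (disch := right; linarith)
    have hlim := hcont.tendsto
    rw [Real.zero_rpow (by linarith), mul_zero, mul_zero, mul_zero] at hlim
    have hlt := (hlim.eventually (gt_mem_nhds (show 0 < κ / 4 by positivity))).filter_mono
      (nhdsWithin_le_nhds (s := Ioi 0))
    obtain ⟨t, ht1, ht2⟩ := (hlt.and (Ioc_mem_nhdsGT (half_pos he0))).exists
    exact ⟨t, ht2.1, ht2.2, ht1.le⟩
  obtain ⟨R, hR1, hR⟩ : ∃ R : ℝ, 1 ≤ R ∧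
      2 * ‖e‖ ^ β * (geomConst (2 * s) * (Lam * R ^ (-(2 * s)))) ≤ κ / 4 := by
    have hlim := (((tendsto_rpow_neg_atTop (show 0 < 2 * s by linarith)).const_mul
      Lam).const_mul (geomConst (2 * s))).const_mul (2 * ‖e‖ ^ β)
    rw [mul_zero, mul_zero, mul_zero] at hlim
    obtain ⟨R, hR1, hR2⟩ := ((hlim.eventually (gt_mem_nhds (show 0 < κ / 4 by positivity))).and
      (Filter.eventually_ge_atTop 1)).exists
    exact ⟨R, hR2, hR1.le⟩
  set X := geomConst (2 * s) * (Lam * τ ^ (-(2 * s))) with hX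
  have hX0 : 0 ≤ X := by positivity
  refine ⟨κ / (12 * (X + 1)), by positivity, fun x hx => ?_⟩
  set ε := κ / (12 * (X + 1)) with hε
  have hε0 : 0 < ε := by positivity
  have hεX : 3 * ε * X ≤ κ / 4 := by
    rw [hε, mul_div_assoc', div_mul_eq_mul_div, div_le_div_iff₀ (by positivity) (by norm_num)]
    nlinarith
  by_contra! hlt
  have hVi : ∀ k q, Integrable (jump 1 (V k) q) (μ k) := fun k q =>
    (h.profile k).integrable_jump hLam (h.elliptic k).1 hβ hβ1 h1 h2 q
  have hlim := (h.equation (x + e)).sub (h.equation x)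
  rw [sub_zero] at hlim
  refine absurd (ge_of_tendsto hlim (b := κ / 4) ?_) (by linarith)
  filter_upwards [hmass, h.eventually_abs_sub_le hβ (isCompact_closedBall 0 (‖x‖ + R + 2))
    (half_pos hε0)] with k hk hclose
  rw [← integral_sub (hVi k _) (hVi k _)]
  have hG : ∀ z, ‖z‖ ≤ ‖x‖ + R + 1 → |(V k (z + e) - V k z) - (W (z + e) - W z)| ≤ ε := by
    intro z hz
    have e1 := abs_le.1 (hclose z (by simp; linarith))
    have e2 := abs_le.1 (hclose (z + e) (by simp; linarith [norm_add_le z e]))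
    exact abs_le.2 ⟨by linarith [e1.2, e2.1], by linarith [e1.1, e2.2]⟩
  have hup : ∀ z, ‖z‖ ≤ ‖x‖ + R + 1 → V k (z + e) - V k z ≤ M + ε := fun z hz => by
    linarith [(abs_le.1 (hG z hz)).2, hM z]
  have hx' : M - 2 * ε ≤ V k (x + e) - V k x := by
    linarith [(abs_le.1 (hG x (by linarith))).1]
  have hxe : V k (x + e + e) - V k (x + e) ≤ M - ε' + ε := by
    linarith [(abs_le.1 (hG (x + e) (by linarith [norm_add_le x e]))).2]
  have hB : ∀ z, |V k (z + e) - V k z| ≤ ‖e‖ ^ β := fun z => by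
    simpa using (h.profile k).holder (z + e) z
  have hlow : ∀ y, τ ≤ ‖y‖ → ‖y‖ < R →
      -(3 * ε) ≤ jump 1 (V k) (x + e) y - jump 1 (V k) x y := by
    intro y _ hyR
    have e1 := hup (x + y) (by linarith [norm_add_le x y])
    have e2 := hup (x - y) (by linarith [norm_sub_le x y])
    rw [add_right_comm] at e1
    rw [← add_sub_right_comm] at e2
    unfold jump
    split_ifs <;> linarith
  have hEτ : ∀ y ∈ ball e τ', ‖e‖ / 2 ≤ ‖y‖ ∧ ‖y‖ < 1 := fun y hy => by
    have e1 := mem_ball_iff_norm.1 hy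
    have e2 := norm_sub_norm_le e y
    have e3 := norm_sub_norm_le y e
    rw [norm_sub_rev] at e2
    constructor <;> linarith
  have hle := le_integral_of_annulus_bounds hs hs1 hLam (h.elliptic k).1
    ((hVi k (x + e)).sub (hVi k x)) (a := C) (b := 3 * ε) (c := 2 * ‖e‖ ^ β)
    (d := 3 * ε' / 8) (τ := τ) (R := R) hC (by positivity) (by positivity) hτ0 (by linarith)
    (E := ball e τ') measurableSet_ball
    (fun y hy => by simpa using hτe.trans (hEτ y hy).1) ?_ ?_ hlow ?_
  · have hreal : c₀ ≤ (μ k).real (ball e τ') := by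
      refine (ENNReal.ofReal_le_iff_le_toReal ?_).1 hk
      refine ((measure_mono fun y hy => ?_).trans_lt
        (((h.elliptic k).1.measure_compl_ball_le hs hLam hτ0).trans_lt ENNReal.ofReal_lt_top)).ne
      simpa using hτe.trans (hEτ y hy).1
    have : κ ≤ 3 * ε' / 8 * (μ k).real (ball e τ') := by
      rw [hκ]; gcongr
    refine le_trans ?_ hle
    linarith
  · intro y hy
    have hy1 : ‖y‖ < 1 := by linarith
    have e1 := abs_le.1 ((h.profile k).second_le (x + e) y hy1.le)
    have e2 := abs_le.1 ((h.profile k).second_le x y hy1.le)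
    simp only [Pi.sub_apply, jump, if_pos hy1]
    linarith [e1.1, e2.2]
  · intro y hy
    have hy1 := (hEτ y hy).2
    have e1 : |V k (x + y + e) - V k (x + e + e)| ≤ ε' / 8 := by
      refine ((h.profile k).holder _ _).trans (le_trans ?_ hτ')
      rw [add_sub_add_right_eq_sub, add_sub_add_left_eq_sub]
      exact Real.rpow_le_rpow (norm_nonneg _) (mem_ball_iff_norm.1 hy).le hβ.le
    have e2 : |V k (x + y) - V k (x + e)| ≤ ε' / 8 := by
      refine ((h.profile k).holder _ _).trans (le_trans ?_ hτ')
      rw [add_sub_add_left_eq_sub]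
      exact Real.rpow_le_rpow (norm_nonneg _) (mem_ball_iff_norm.1 hy).le hβ.le
    have e3 := hup (x - y) (by linarith [norm_sub_le x y])
    rw [← add_sub_right_comm] at e3
    rw [add_right_comm] at e1
    simp only [Pi.sub_apply, jump, if_pos hy1]
    linarith [(abs_le.1 e1).2, (abs_le.1 e2).1]
  · intro y hy
    have e1 := abs_le.1 (hB x)
    have e2 := abs_le.1 (hB (x + y))
    rw [add_right_comm] at e2
    simp only [Pi.sub_apply, jump, if_neg (not_lt.2 (hR1.trans hy))]
    linarith [e1.1, e2.2]

lemma increment_nonpos (h : IsBlowupLimit s β lam Lam C F μ V W) (hs : 0 < s) (hs1 : s < 1)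
    (hLam : 0 ≤ Lam) (hC : 0 ≤ C) (hβ : 0 < β) (hβ1 : β < 1) (h1 : 2 * s < β + 1)
    (h2 : β < 2 * s) {e : Euc n} (he : e ∈ charged F μ) (he2 : ‖e‖ < 1 / 2) (x : Euc n) :
    W (x + e) - W x ≤ 0 := by
  rcases eq_or_ne e 0 with rfl | he0
  · simp
  have hbdd : BddAbove (range fun x => W (x + e) - W x) := by
    refine ⟨‖e‖ ^ β, ?_⟩
    rintro _ ⟨x, rfl⟩
    simpa using (le_abs_self _).trans (h.holder (x + e) x)
  set M := ⨆ x, W (x + e) - W x with hM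
  have hMle : ∀ x, W (x + e) - W x ≤ M := fun x => le_ciSup hbdd x
  refine (hMle x).trans ?_
  by_contra! hM0
  have hiter : ∀ N : ℕ, ∀ ε' : ℝ, 0 < ε' → ∃ ε, 0 < ε ∧ ∀ x, M - ε ≤ W (x + e) - W x →
      ∀ j ≤ N, M - ε' ≤ W (x + j • e + e) - W (x + j • e) := by
    intro N
    induction N with
    | zero =>
      intro ε' hε'
      refine ⟨ε', hε', fun x hx j hj => ?_⟩
      obtain rfl : j = 0 := by omega
      simpa using hx
    | succ N ih =>
      intro ε' hε'
      obtain ⟨ε₁, hε₁, hN⟩ := ih ε' hε'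
      obtain ⟨ε₂, hε₂, hstep⟩ :=
        h.exists_increment_ge hs hs1 hLam hC hβ hβ1 h1 h2 he he0 he2 hMle hε₁
      refine ⟨min ε₂ ε', lt_min hε₂ hε', fun x hx j hj => ?_⟩
      rcases j with _ | j
      · have := min_le_right ε₂ ε'
        simp only [zero_smul, add_zero]
        linarith
      · have := hN (x + e) (hstep x (by linarith [min_le_left ε₂ ε'])) j (by omega)
        rwa [succ_nsmul', ← add_assoc]
  have hgrow : ∀ N : ℕ, N * (M / 2) ≤ (N : ℝ) ^ β * ‖e‖ ^ β := by
    intro N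
    obtain ⟨ε, hε, hN⟩ := hiter N (M / 2) (by linarith)
    obtain ⟨x, hx⟩ := exists_lt_of_lt_ciSup (show M - ε < ⨆ x, W (x + e) - W x by linarith)
    have hsum : ∀ j ≤ N, j * (M / 2) ≤ W (x + j • e) - W x := by
      intro j
      induction j with
      | zero => simp
      | succ j ih =>
        intro hj
        have e1 := ih (by omega)
        have e2 := hN x hx.le j (by omega)
        rw [succ_nsmul, ← add_assoc]
        push_cast
        linarith
    refine (hsum N le_rfl).trans ((le_abs_self _).trans ((h.holder _ _).trans (le_of_eq ?_)))
    rw [add_sub_cancel_left, ← Nat.cast_smul_eq_nsmul ℝ, norm_smul, Real.norm_natCast,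
      Real.mul_rpow (by positivity) (by positivity)]
  have hlim : Filter.Tendsto (fun N : ℕ => (N : ℝ) ^ (-(1 - β)) * ‖e‖ ^ β) Filter.atTop (𝓝 0) := by
    simpa using ((tendsto_rpow_neg_atTop (show 0 < 1 - β by linarith)).comp
      tendsto_natCast_atTop_atTop).mul_const (‖e‖ ^ β)
  refine absurd (ge_of_tendsto hlim (b := M / 2) ?_) (by linarith)
  filter_upwards [Filter.eventually_gt_atTop 0] with N hN
  have hN0 : (0 : ℝ) < N := by exact_mod_cast hN
  rw [neg_sub, Real.rpow_sub hN0, Real.rpow_one, div_mul_eq_mul_div, le_div_iff₀ hN0, mul_comm]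
  exact hgrow N

lemma add_eq (h : IsBlowupLimit s β lam Lam C F μ V W) (hs : 0 < s) (hs1 : s < 1)
    (hLam : 0 ≤ Lam) (hC : 0 ≤ C) (hβ : 0 < β) (hβ1 : β < 1) (h1 : 2 * s < β + 1)
    (h2 : β < 2 * s) {e : Euc n} (he : e ∈ charged F μ) (he2 : ‖e‖ < 1 / 2) (x : Euc n) :
    W (x + e) = W x := by
  have e1 := h.increment_nonpos hs hs1 hLam hC hβ hβ1 h1 h2 he he2 x
  have e2 := h.neg.increment_nonpos hs hs1 hLam hC hβ hβ1 h1 h2 he he2 x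
  linarith

lemma eq_apply_zero (h : IsBlowupLimit s β lam Lam C F μ V W) (hs : 0 < s) (hs1 : s < 1)
    (hlam : 0 < lam) (hLam : 0 ≤ Lam) (hC : 0 ≤ C) (hβ : 0 < β) (hβ1 : β < 1)
    (h1 : 2 * s < β + 1) (h2 : β < 2 * s) (x : Euc n) : W x = W 0 := by
  have hbound : ∀ r : ℝ, 0 < r → r < 1 / 2 → |W x - W 0| ≤ (n * r) ^ β := by
    intro r hr hr2
    set T : Set (Euc n) := charged F μ ∩ closedBall 0 r with hT
    have hspan : ⊤ ≤ Submodule.span ℝ T := by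
      rw [top_le_iff]
      by_contra hne
      obtain ⟨v, hv, hv0⟩ := (Submodule.span ℝ T)ᗮ.ne_bot_iff.1
        (fun hbot => hne ((Submodule.orthogonal_eq_bot_iff).1 hbot))
      have hv1 : ‖‖v‖⁻¹ • v‖ = 1 := by
        rw [norm_smul, norm_inv, norm_norm, inv_mul_cancel₀ (norm_ne_zero_iff.2 hv0)]
      obtain ⟨y, hy, hyr, hne0⟩ := exists_charged_inner_ne_zero hs hs1 hlam hLam h.elliptic hr hv1
      refine hne0 ?_
      rw [real_inner_smul_left, real_inner_comm,
        hv y (Submodule.subset_span ⟨hy, by simpa using hyr⟩), mul_zero]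
    obtain ⟨b, hb⟩ : ∃ b : Module.Basis (Fin n) ℝ (Euc n), ∀ i, b i ∈ T := by
      let b := Module.Basis.ofSpan hspan
      have := Module.Finite.finite_basis b
      have := Fintype.ofFinite
        ((linearIndepOn_empty ℝ (id : Euc n → Euc n)).extend (empty_subset T))
      refine ⟨b.reindex (Fintype.equivFinOfCardEq
        ((Module.finrank_eq_card_basis b).symm.trans finrank_euclideanSpace_fin)), fun i => ?_⟩
      rw [Module.Basis.reindex_apply]
      exact Module.Basis.ofSpan_subset hspan (mem_range_self _)
    have hbr : ∀ i, ‖b i‖ ≤ r := fun i => by simpa using (hb i).2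
    let P : AddSubgroup (Euc n) :=
      { carrier := {p | ∀ q, W (q + p) = W q}
        zero_mem' := fun q => by simp
        add_mem' := fun {p p'} hp hp' q => by rw [← add_assoc, hp', hp]
        neg_mem' := fun {p} hp q => by simpa using (hp (q + -p)).symm }
    have hbP : ∀ i, b i ∈ P := fun i q =>
      h.add_eq hs hs1 hLam hC hβ hβ1 h1 h2 (hb i).1 ((hbr i).trans_lt hr2) q
    have hsum : ∑ i, ⌊b.repr x i⌋ • b i ∈ P := P.sum_mem fun i _ => P.zsmul_mem (hbP i) _
    have hx : x = ∑ i, Int.fract (b.repr x i) • b i + ∑ i, ⌊b.repr x i⌋ • b i := by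
      nth_rw 1 [← b.sum_repr x]
      rw [← Finset.sum_add_distrib]
      refine Finset.sum_congr rfl fun i _ => ?_
      rw [← Int.cast_smul_eq_zsmul ℝ, ← add_smul, Int.fract_add_floor]
    have hW : W x = W (∑ i, Int.fract (b.repr x i) • b i) := by
      nth_rw 1 [hx]
      exact hsum _
    rw [hW]
    refine (h.holder _ _).trans (Real.rpow_le_rpow (norm_nonneg _) ?_ hβ.le)
    rw [sub_zero]
    refine (norm_sum_le_of_le (f := fun i => Int.fract (b.repr x i) • b i) (n := fun _ => r) _
      fun i _ => ?_).trans (by simp)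
    rw [norm_smul, Real.norm_of_nonneg (Int.fract_nonneg _)]
    exact (mul_le_of_le_one_left (norm_nonneg _) (Int.fract_lt_one _).le).trans (hbr i)
  have hcont : ContinuousAt (fun r : ℝ => (n * r) ^ β) 0 := by
    fun_prop (disch := right; linarith)
  have hlim := hcont.tendsto
  rw [mul_zero, Real.zero_rpow hβ.ne'] at hlim
  have hle : |W x - W 0| ≤ 0 := by
    refine ge_of_tendsto (hlim.mono_left (nhdsWithin_le_nhds (s := Ioi 0))) ?_
    filter_upwards [Ioo_mem_nhdsGT (show (0 : ℝ) < 1 / 2 by norm_num)] with r hr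
    exact hbound r hr.1 hr.2
  exact sub_eq_zero.1 (abs_nonpos_iff.1 hle)

end IsBlowupLimit

/-- The mollified blow-up of `u` at `x` and scale `r`, normalised to vanish at the origin. -/
def blowupProfile (β H : ℝ) (u φ : Euc n → ℝ) (x : Euc n) (r : ℝ) (ξ : Euc n) : ℝ :=
  mollify (blowup u x r (H * r ^ β)) φ 1 ξ - mollify (blowup u x r (H * r ^ β)) φ 1 0

lemma blowup_sub_le {β H r : ℝ} {u : Euc n → ℝ} (hH : 0 < H) (hr : 0 < r)
    (hu : ∀ x y, |u x - u y| ≤ H * ‖x - y‖ ^ β) (x ξ ζ : Euc n) :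
    |blowup u x r (H * r ^ β) ξ - blowup u x r (H * r ^ β) ζ| ≤ ‖ξ - ζ‖ ^ β := by
  have hh : 0 < H * r ^ β := by positivity
  rw [blowup, blowup, ← mul_sub, abs_mul, abs_inv, abs_of_pos hh, inv_mul_le_iff₀ hh]
  refine (hu _ _).trans (le_of_eq ?_)
  rw [add_sub_add_left_eq_sub, ← smul_sub, norm_smul, Real.norm_of_nonneg hr.le,
    Real.mul_rpow hr.le (norm_nonneg _), mul_assoc]

lemma continuous_blowup {u : Euc n → ℝ} (hu : Continuous u) (x : Euc n) (r h : ℝ) :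
    Continuous (blowup u x r h) := by
  unfold blowup; fun_prop

lemma isProfile_blowupProfile {A β H r : ℝ} {u φ : Euc n → ℝ} (hφ : IsKernelBump A φ)
    (hβ : 0 < β) (hH : 0 < H) (hr : 0 < r) (huc : Continuous u)
    (hu : ∀ x y, |u x - u y| ≤ H * ‖x - y‖ ^ β) (x : Euc n) :
    IsProfile β (2 ^ β * A * volume.real (ball (0 : Euc n) 2)) (blowupProfile β H u φ x r) := by
  have hc := continuous_blowup huc x r (H * r ^ β)
  have hb := blowup_sub_le hH hr hu x
  refine ⟨fun ξ ζ => ?_, fun ξ y hy => ?_⟩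
  · simpa [blowupProfile] using hφ.mollify_sub_le hc hb ξ ζ
  · convert hφ.second_difference_mollify_le hβ hc hb ξ hy using 2
    unfold blowupProfile; ring

lemma abs_sub_le_blowupProfile {A β H r : ℝ} {u φ : Euc n → ℝ} (hφ : IsKernelBump A φ)
    (hβ : 0 < β) (hH : 0 < H) (hr : 0 < r) (huc : Continuous u)
    (hu : ∀ x y, |u x - u y| ≤ H * ‖x - y‖ ^ β) (x ξ : Euc n) :
    |u (x + r • ξ) - u x| ≤ H * r ^ β * (|blowupProfile β H u φ x r ξ| + 2) := by
  have hc := continuous_blowup huc x r (H * r ^ β)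
  have hb := blowup_sub_le hH hr hu x
  have hh : 0 < H * r ^ β := by positivity
  have h1 := hφ.abs_mollify_sub_self_le hβ hc hb ξ
  have h2 := hφ.abs_mollify_sub_self_le hβ hc hb 0
  have h3 : u (x + r • ξ) - u x = H * r ^ β *
      (blowup u x r (H * r ^ β) ξ - blowup u x r (H * r ^ β) 0) := by
    rw [blowup, blowup, smul_zero, add_zero, ← mul_sub, mul_inv_cancel_left₀ hh.ne']
  rw [h3, abs_mul, abs_of_pos hh]
  refine mul_le_mul_of_nonneg_left ?_ hh.le
  have e1 := abs_le.1 h1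
  have e2 := abs_le.1 h2
  have e3 := abs_le.1 (le_refl |blowupProfile β H u φ x r ξ|)
  unfold blowupProfile at e3 ⊢
  exact abs_le.2 ⟨by linarith [e1.2, e2.1, e3.1], by linarith [e1.1, e2.2, e3.2]⟩

lemma jump_sub_const (r : ℝ) (V : Euc n → ℝ) (c : ℝ) (p y : Euc n) :
    jump r (fun ξ => V ξ - c) p y = jump r V p y := by
  unfold jump; split_ifs <;> ring

lemma abs_integral_jump_blowupProfile_le {s lam Lam β r A H η N : ℝ} (hn : 1 ≤ n)
    {K : Euc n → Measure (Euc n)} {u f φ : Euc n → ℝ} (hs : 0 < s) (hs1 : s < 1) (hLam : 0 ≤ Lam)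
    (hη : 0 ≤ η) (hKm : MeasKernel K) (hKs : DivSymmetric K) (hK : DivElliptic s lam Lam K)
    (hX : XReg s 0 η K) (hβ : s < β) (hβ2 : β < 2 * s) (hr : 0 < r) (hH : 0 < H) (hN : 0 ≤ N)
    (huc : Continuous u) (hu : ∀ x y, |u x - u y| ≤ H * ‖x - y‖ ^ β) (hφ : IsKernelBump A φ)
    (hsol : WeakSol K u f (ball 0 1))
    (hf : eLpNorm f (ENNReal.ofReal ((n : ℝ) / (2 * s - β))) (volume.restrict (ball 0 1)) ≤
      ENNReal.ofReal N)
    (x ξ : Euc n) (hp : closedBall (x + r • ξ) r ⊆ ball 0 1) :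
    |∫ y, jump 1 (blowupProfile β H u φ x r) ξ y ∂(rescaled s K x r)| ≤
      approxConst n s β A * (η + N / H) := by
  have h1 := abs_integral_jump_mollify_le hn hs hs1 hLam hη hKm hKs hK hX hβ hβ2 hr hH.le hN huc
    hu hφ.toIsBump hsol hf (x + r • ξ) x hp
  have h2 : ∀ y, jump 1 (blowupProfile β H u φ x r) ξ y =
      jump 1 (mollify (blowup u x r (H * r ^ β)) φ 1) ξ y := jump_sub_const _ _ _ _
  simp_rw [h2]
  have hpos : 0 < r ^ (2 * s) * (H * r ^ β)⁻¹ * (r ^ n)⁻¹ := by positivity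
  rw [integral_jump_rescaled hr, abs_mul, abs_of_pos hpos]
  refine (mul_le_mul_of_nonneg_left h1 hpos.le).trans (le_of_eq ?_)
  rw [Real.rpow_sub hr, Real.rpow_add hr, Real.rpow_natCast]
  field_simp

lemma hSemi_of_le_one {β : ℝ} (hβ : 0 < β) (hβ1 : β ≤ 1) (Ω : Set (Euc n)) (u : Euc n → ℝ) :
    hSemi β Ω u = ⨆ (x : Ω) (y : Ω), ENNReal.ofReal (|u x - u y| / ‖(x : Euc n) - y‖ ^ β) := by
  have hdeg : hDeg β = 0 := by
    have : ⌈β⌉₊ = 1 := (Nat.ceil_eq_iff one_ne_zero).2 ⟨by simpa using hβ, by simpa using hβ1⟩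
    rw [hDeg, this]
  have h0 : ∀ x y, ‖iteratedFDerivWithin ℝ 0 u Ω x - iteratedFDerivWithin ℝ 0 u Ω y‖ =
      |u x - u y| := fun x y => by
    rw [iteratedFDerivWithin_zero_eq_comp, Function.comp_apply, Function.comp_apply, ← map_sub,
      LinearIsometryEquiv.norm_map, Real.norm_eq_abs]
  unfold hSemi hSemiOn
  generalize hDeg β = d at hdeg ⊢
  subst hdeg
  simp only [h0, Nat.cast_zero, sub_zero]

lemma abs_sub_le_hSemi {β : ℝ} (hβ : 0 < β) (hβ1 : β ≤ 1) {u : Euc n → ℝ}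
    (hu : hSemi β univ u ≠ ⊤) (x y : Euc n) :
    |u x - u y| ≤ (hSemi β univ u).toReal * ‖x - y‖ ^ β := by
  rcases eq_or_ne x y with rfl | hxy
  · simp [Real.zero_rpow hβ.ne']
  have hpos : 0 < ‖x - y‖ := norm_pos_iff.2 (sub_ne_zero.2 hxy)
  rw [← div_le_iff₀ (by positivity)]
  refine (ENNReal.ofReal_le_iff_le_toReal hu).1 ?_
  rw [hSemi_of_le_one hβ hβ1]
  exact le_iSup₂_of_le (⟨x, trivial⟩ : (univ : Set (Euc n))) ⟨y, trivial⟩ le_rfl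

/-- A pair of points at which the interpolation estimate fails. -/
lemma exists_pair_of_lt_hSemi {β δ c : ℝ} (hβ : 0 < β) (hβ1 : β ≤ 1) (hδ : 0 < δ) (hc : 0 < c)
    {u : Euc n → ℝ} (hu : hSemi β univ u ≠ ⊤) {B : ℝ≥0∞}
    (h : ENNReal.ofReal δ * hSemi β univ u + ENNReal.ofReal c * (supNorm (ball 0 1) u + B) <
      hSemi β (ball 0 (1 / 2)) u) :
    ∃ H N : ℝ, ∃ x y : Euc n, 0 < H ∧ 0 ≤ N ∧ ‖x‖ < 1 / 2 ∧ x ≠ y ∧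
      (∀ x y, |u x - u y| ≤ H * ‖x - y‖ ^ β) ∧ δ * H * ‖x - y‖ ^ β < |u x - u y| ∧
      B ≤ ENNReal.ofReal N ∧ N / H ≤ 1 / c ∧ ‖x - y‖ ^ β ≤ 2 / c := by
  set H := (hSemi β univ u).toReal with hHdef
  rw [hSemi_of_le_one hβ hβ1 (ball 0 (1 / 2))] at h
  obtain ⟨x, h⟩ := lt_iSup_iff.1 h
  obtain ⟨y, hxy⟩ := lt_iSup_iff.1 h
  obtain ⟨x, hx⟩ := x
  obtain ⟨y, hy⟩ := y
  simp only at hxy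
  have hne : x ≠ y := by
    rintro rfl
    simp at hxy
  have hρ : 0 < ‖x - y‖ := norm_pos_iff.2 (sub_ne_zero.2 hne)
  have hρβ : 0 < ‖x - y‖ ^ β := by positivity
  have hfin : supNorm (ball 0 1) u + B ≠ ⊤ := by
    intro htop
    rw [htop, ENNReal.mul_top (by simpa using hc), add_top] at hxy
    exact absurd hxy not_top_lt
  set N := (supNorm (ball 0 1) u + B).toReal with hNdef
  have hN0 : 0 ≤ N := ENNReal.toReal_nonneg
  have hH0 : 0 ≤ H := ENNReal.toReal_nonneg
  rw [← ENNReal.ofReal_toReal hu, ← ENNReal.ofReal_toReal hfin, ← ENNReal.ofReal_mul hδ.le,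
    ← ENNReal.ofReal_mul hc.le, ← ENNReal.ofReal_add (by positivity) (by positivity),
    ENNReal.ofReal_lt_ofReal_iff_of_nonneg (by positivity), lt_div_iff₀ hρβ, ← hHdef,
    ← hNdef] at hxy
  have hsup : ∀ z ∈ ball (0 : Euc n) (1 / 2), |u z| ≤ N := fun z hz => by
    refine (ENNReal.ofReal_le_iff_le_toReal hfin).1 (le_add_right ?_)
    exact le_iSup_of_le (⟨z, ball_subset_ball (by norm_num) hz⟩ : ball (0 : Euc n) 1) le_rfl
  have hu' := abs_sub_le_hSemi hβ hβ1 hu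
  have h1 := hu' x y
  have h2 : |u x - u y| ≤ 2 * N := by
    have := abs_sub (u x) (u y)
    linarith [hsup x hx, hsup y hy]
  have h3 : 0 ≤ δ * H * ‖x - y‖ ^ β := by positivity
  have h4 : 0 ≤ c * N * ‖x - y‖ ^ β := by positivity
  rw [add_mul] at hxy
  have hH : 0 < H := by
    by_contra! hH
    have : H = 0 := le_antisymm hH hH0
    rw [← hHdef, this, zero_mul] at h1
    linarith
  have hN : 0 < N := by linarith
  refine ⟨H, N, x, y, hH, hN0, by simpa using hx, hne, hu', by linarith, ?_, ?_, ?_⟩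
  · rw [ENNReal.ofReal_toReal hfin]
    exact le_add_self
  · rw [div_le_div_iff₀ hH hc, one_mul]
    have : c * N * ‖x - y‖ ^ β ≤ H * ‖x - y‖ ^ β := by linarith
    linarith [le_of_mul_le_mul_right this hρβ]
  · rw [le_div_iff₀ hc]
    have : N * (‖x - y‖ ^ β * c) ≤ N * 2 := by linarith
    exact le_of_mul_le_mul_left this hN

lemma exists_tendsto_of_isCompact {X : Type*} [TopologicalSpace X] (F : Ultrafilter ℕ) {Q : Set X}
    (hQ : IsCompact Q) {g : ℕ → X} (hg : ∀ k, g k ∈ Q) :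
    ∃ x ∈ Q, Filter.Tendsto g F (𝓝 x) :=
  hQ.ultrafilter_le_nhds (F.map g)
    (Filter.le_principal_iff.2 (Ultrafilter.mem_map.2 (Filter.univ_mem' hg)))

/-- **Interpolation-type a priori estimate for divergence-form equations with small
oscillation** (Proposition 5.2). For `q = n/(2s−β)`: for any `δ > 0` there are `C_δ` and
`η_δ > 0` such that, for any uniformly elliptic divergence-form kernel with oscillation at
most `η_δ`,
`[u]_{C^β(B_{1/2})} ≤ δ [u]_{C^β(ℝⁿ)} + C_δ (‖u‖_{L^∞(B₁)} + ‖f‖_{L^q(B₁)})`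
for any compactly supported `u ∈ C^β(ℝⁿ)` weakly solving `L(u,x) = f` in `B₁`. -/
theorem stmt11 (n : ℕ) (s β lam Lam : ℝ)
    (hs : s ∈ Set.Ioo (0 : ℝ) 1) (hβ : β ∈ Set.Ioo s (min 1 (2 * s)))
    (hlam : 0 < lam) (hlamLam : lam ≤ Lam) :
    ∀ δ > (0 : ℝ), ∃ Cδ > (0 : ℝ), ∃ ηδ > (0 : ℝ),
      ∀ K : Euc n → Measure (Euc n),
        MeasKernel K → DivSymmetric K → DivElliptic s lam Lam K →
        XReg s 0 ηδ K → AlmostEven s 0 ηδ K →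
        ∀ u f : Euc n → ℝ,
          HasCompactSupport u →
          Continuous u →
          hSemi β Set.univ u ≠ ⊤ →
          WeakSol K u f (ball 0 1) →
          hSemi β (ball 0 (1 / 2)) u ≤
            ENNReal.ofReal δ * hSemi β Set.univ u +
              ENNReal.ofReal Cδ *
                (supNorm (ball 0 1) u +
                  eLpNorm f (ENNReal.ofReal ((n : ℝ) / (2 * s - β)))
                    (volume.restrict (ball 0 1))) := by
  obtain ⟨hs0, hs1⟩ := hs
  obtain ⟨hsβ, hβ'⟩ := hβ
  have hβ1 : β < 1 := hβ'.trans_le (min_le_left _ _)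
  have hβ2 : β < 2 * s := hβ'.trans_le (min_le_right _ _)
  have hβ0 : 0 < β := hs0.trans hsβ
  have hLam : 0 ≤ Lam := hlam.le.trans hlamLam
  intro δ hδ
  by_contra! hcon
  have hfail : ∀ k : ℕ, ∃ K : Euc n → Measure (Euc n), ∃ u f : Euc n → ℝ, ∃ H N : ℝ,
      ∃ x y : Euc n, MeasKernel K ∧ DivSymmetric K ∧ DivElliptic s lam Lam K ∧
        XReg s 0 (1 / ((k : ℝ) + 1)) K ∧ Continuous u ∧ WeakSol K u f (ball 0 1) ∧
        0 < H ∧ 0 ≤ N ∧ ‖x‖ < 1 / 2 ∧ x ≠ y ∧ (∀ x y, |u x - u y| ≤ H * ‖x - y‖ ^ β) ∧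
        δ * H * ‖x - y‖ ^ β < |u x - u y| ∧
        eLpNorm f (ENNReal.ofReal ((n : ℝ) / (2 * s - β))) (volume.restrict (ball 0 1)) ≤
          ENNReal.ofReal N ∧ N / H ≤ 1 / ((k : ℝ) + 1) ∧ ‖x - y‖ ^ β ≤ 2 / ((k : ℝ) + 1) := by
    intro k
    have hk : (0 : ℝ) < (k : ℝ) + 1 := by positivity
    obtain ⟨K, hKm, hKs, hK, hX, -, u, f, -, huc, hu, hsol, hlt⟩ :=
      hcon ((k : ℝ) + 1) hk (1 / ((k : ℝ) + 1)) (by positivity)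
    obtain ⟨H, N, x, y, h⟩ := exists_pair_of_lt_hSemi hβ0 hβ1.le hδ hk hu hlt
    exact ⟨K, u, f, H, N, x, y, hKm, hKs, hK, hX, huc, hsol, h⟩
  choose K u f H N x y hKm hKs hK hX huc hsol hH hN hx hxy hu hgap hf hNH hρ using hfail
  have hn : 1 ≤ n := by
    by_contra! hn
    obtain rfl : n = 0 := by omega
    exact hxy 0 (Subsingleton.elim _ _)
  obtain ⟨A, φ, hφ⟩ := exists_isKernelBump n
  have hA : 0 ≤ A := hφ.toIsBump.nonneg
  set R := (3 / δ) ^ β⁻¹ with hRdef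
  have hR : 0 < R := by positivity
  have hRβ : δ * R ^ β = 3 := by
    rw [hRdef, Real.rpow_inv_rpow (by positivity) hβ0.ne']
    field_simp
  have hdist : ∀ k, 0 < ‖x k - y k‖ := fun k => norm_pos_iff.2 (sub_ne_zero.2 (hxy k))
  set r : ℕ → ℝ := fun k => ‖x k - y k‖ / R with hrdef
  have hr : ∀ k, 0 < r k := fun k => div_pos (hdist k) hR
  set e : ℕ → Euc n := fun k => (r k)⁻¹ • (y k - x k) with hedef
  have hxe : ∀ k, x k + r k • e k = y k := fun k => by
    simp only [hedef, smul_inv_smul₀ (hr k).ne', add_sub_cancel]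
  have he : ∀ k, e k ∈ closedBall (0 : Euc n) R := fun k => by
    have h0 := (hdist k).ne'
    simp only [mem_closedBall_zero_iff, hedef, hrdef, norm_smul, norm_inv, norm_div, norm_norm,
      Real.norm_of_nonneg hR.le, norm_sub_rev (y k)]
    exact le_of_eq (by field_simp)
  set V : ℕ → Euc n → ℝ := fun k => blowupProfile β (H k) (u k) φ (x k) (r k) with hVdef
  have hV : ∀ k, IsProfile β (2 ^ β * A * volume.real (ball (0 : Euc n) 2)) (V k) := fun k =>
    isProfile_blowupProfile hφ hβ0 (hH k) (hr k) (huc k) (hu k) (x k)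
  have hV0 : ∀ k, V k 0 = 0 := fun k => sub_self _
  have hVe : ∀ k, 1 < |V k (e k)| := by
    intro k
    have h1 := abs_sub_le_blowupProfile hφ hβ0 (hH k) (hr k) (huc k) (hu k) (x k) (e k)
    rw [hxe, abs_sub_comm] at h1
    have h2 := (hgap k).trans_le h1
    have h3 : ‖x k - y k‖ ^ β = R ^ β * r k ^ β := by
      rw [← Real.mul_rpow hR.le (hr k).le, hrdef, mul_div_cancel₀ _ hR.ne']
    have h4 : 0 < H k * r k ^ β := mul_pos (hH k) (Real.rpow_pos_of_pos (hr k) β)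
    have h5 : H k * r k ^ β * 3 < H k * r k ^ β * (|V k (e k)| + 2) := by
      rw [← hRβ]
      refine lt_of_eq_of_lt ?_ h2
      rw [h3]; ring
    linarith [lt_of_mul_lt_mul_left h5 h4.le]
  have hsmall : Filter.Tendsto (fun k : ℕ => 1 / ((k : ℝ) + 1)) Filter.atTop (𝓝 0) :=
    tendsto_one_div_add_atTop_nhds_zero_nat
  have hr0 : Filter.Tendsto r Filter.atTop (𝓝 0) := by
    have h1 : Filter.Tendsto (fun k : ℕ => (2 * (1 / ((k : ℝ) + 1))) ^ β⁻¹ / R)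
        Filter.atTop (𝓝 0) := by
      have h2 := ((hsmall.const_mul 2).rpow_const (p := β⁻¹) (Or.inr (by positivity))).div_const R
      rwa [mul_zero, Real.zero_rpow (by positivity), zero_div] at h2
    refine squeeze_zero (fun k => (hr k).le) (fun k => ?_) h1
    refine div_le_div_of_nonneg_right ?_ hR.le
    rw [← Real.rpow_rpow_inv (hdist k).le hβ0.ne', mul_one_div]
    exact Real.rpow_le_rpow (by positivity) (hρ k) (by positivity)
  let F : Ultrafilter ℕ := Filter.hyperfilter ℕ
  have hF : (F : Filter ℕ) ≤ Filter.atTop := Nat.hyperfilter_le_atTop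
  have hlimV : ∀ ξ, ∃ w, Filter.Tendsto (fun k => V k ξ) F (𝓝 w) := fun ξ => by
    obtain ⟨w, -, hw⟩ := exists_tendsto_of_isCompact F
      (isCompact_Icc (a := -‖ξ‖ ^ β) (b := ‖ξ‖ ^ β)) (g := fun k => V k ξ) fun k => by
        have := (hV k).holder ξ 0
        rw [hV0, sub_zero, sub_zero] at this
        exact abs_le.1 this
    exact ⟨w, hw⟩
  choose W hW using hlimV
  have hlim : IsBlowupLimit s β lam Lam (2 ^ β * A * volume.real (ball (0 : Euc n) 2)) F
      (fun k => rescaled s (K k) (x k) (r k)) V W := by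
    refine ⟨fun k => rescaled_jumpElliptic (hK k) (x k) (hr k), hV, hW, fun ξ => ?_⟩
    have hbd : Filter.Tendsto (fun k : ℕ => approxConst n s β A *
        (1 / ((k : ℝ) + 1) + 1 / ((k : ℝ) + 1))) F (𝓝 0) := by
      simpa using ((hsmall.add hsmall).const_mul (approxConst n s β A)).mono_left hF
    refine squeeze_zero_norm' ?_ hbd
    have hin : ∀ᶠ k in Filter.atTop, r k * (‖ξ‖ + 1) < 1 / 2 := by
      have h1 := hr0.mul_const (‖ξ‖ + 1)
      rw [zero_mul] at h1
      exact h1.eventually (gt_mem_nhds (by norm_num))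
    filter_upwards [hin.filter_mono hF] with k hk
    have hsub : closedBall (x k + r k • ξ) (r k) ⊆ ball 0 1 := fun z hz => by
      rw [mem_closedBall_iff_norm] at hz
      rw [mem_ball_zero_iff]
      have h1 : ‖x k + r k • ξ‖ ≤ ‖x k‖ + r k * ‖ξ‖ := by
        refine (norm_add_le _ _).trans_eq ?_
        rw [norm_smul, Real.norm_of_nonneg (hr k).le]
      have h2 := norm_sub_norm_le z (x k + r k • ξ)
      linarith [hx k]
    refine (abs_integral_jump_blowupProfile_le hn hs0 hs1 hLam (by positivity) (hKm k) (hKs k)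
      (hK k) (hX k) hsβ hβ2 (hr k) (hH k) (hN k) (huc k) (hu k) hφ (hsol k) (hf k) (x k) ξ
      hsub).trans ?_
    have hap : 0 ≤ approxConst n s β A := by
      have := weightConst_pos (s := s) (β := β) (by linarith) hβ2
      unfold approxConst; positivity
    exact mul_le_mul_of_nonneg_left (add_le_add_right (hNH k) _) hap
  have hconst := hlim.eq_apply_zero hs0 hs1 hlam hLam (by positivity) hβ0 hβ1 (by linarith) hβ2
  obtain ⟨e₀, -, he₀⟩ := exists_tendsto_of_isCompact F (isCompact_closedBall (0 : Euc n) R) he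
  have hW0 : W 0 = 0 := by
    refine tendsto_nhds_unique (hW 0) ?_
    simp only [hV0, tendsto_const_nhds]
  have hup : Filter.Tendsto (fun k => ‖e k - e₀‖ ^ β + |V k e₀|) F (𝓝 0) := by
    have h1 := (tendsto_iff_norm_sub_tendsto_zero.1 he₀).rpow_const (p := β) (Or.inr hβ0.le)
    have h2 := h1.add (hW e₀).abs
    rwa [hconst, hW0, Real.zero_rpow hβ0.ne', abs_zero, add_zero] at h2
  refine absurd (ge_of_tendsto hup (b := 1) (Filter.Eventually.of_forall fun k => ?_)) (by norm_num)
  have h1 := (hV k).holder (e k) e₀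
  have h2 := abs_sub_abs_le_abs_sub (V k (e k)) (V k e₀)
  linarith [hVe k]

end
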